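/- arXiv:2307.03446 — 3 statements merged into one kernel-verified Lean document; each statement's English description precedes it below -/
import Mathlib

section
/- 3-SAT is projection-universal for finite simplicial complexes: for every geometric simplicial complex K in a Euclidean space (Fin n → ℝ) with finitely many faces, there exist a natural number d, a CNF formula Φ over Fin d each of whose clauses has at most 3 literals, and a set D ⊆ Fin d, such that the induced cubical complex N(π_D(disc(Φ))) is homeomorphic to the underlying space |K| of K. -/
/-- The discrete solution space of a CNF formula. -/
def cnfDisc {V : Type*} (Φ : Finset (Finset (V × Bool))) : Set (V → Bool) :=
  {x | ∀ C ∈ Φ, ∃ l ∈ C, x l.1 = l.2}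

/-- The induced cubical complex of a set `X` of Boolean vertices of the unit cube. -/
def inducedCubicalComplex {V : Type*} (X : Set (V → Bool)) : Set (V → ℝ) :=
  {p | (∀ i, 0 ≤ p i ∧ p i ≤ 1) ∧
    ∀ v : V → Bool, (∀ i, (p i = 0 → v i = false) ∧ (p i = 1 → v i = true)) → v ∈ X}

/-- The projection forgetting the coordinates in `D`. -/
def proj {d : ℕ} (D : Set (Fin d)) (x : Fin d → Bool) : {i : Fin d // i ∉ D} → Bool :=
  fun i => x i.1

/-- The vertex sets of the faces of `K`, as Boolean vectors indexed by an enumeration of vertices. -/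
def faceIndicators {n m : ℕ} (K : Geometry.SimplicialComplex ℝ (Fin n → ℝ)) (f : Fin m → Fin n → ℝ) :
    Set (Fin m → Bool) :=
  {v | (Finset.univ.filter fun i => v i = true).image f ∈ K.faces}

theorem mem_inducedCubicalComplex_faceIndicators {n m : ℕ}
    {K : Geometry.SimplicialComplex ℝ (Fin n → ℝ)} {f : Fin m → Fin n → ℝ} {p : Fin m → ℝ} :
    p ∈ inducedCubicalComplex (faceIndicators K f) ↔
      (∀ i, 0 ≤ p i ∧ p i ≤ 1) ∧ (∃ i, p i = 1) ∧
        (Finset.univ.filter fun i => p i ≠ 0).image f ∈ K.faces := by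
  classical
  refine and_congr_right fun _ => ⟨fun h => ⟨?_, ?_⟩, ?_⟩
  · have h1 := h (fun i => decide (p i = 1)) fun i => by
      constructor
      · intro h0; simp [h0]
      · intro h0; simp [h0]
    obtain ⟨_, hy⟩ := K.nonempty_of_mem_faces h1
    obtain ⟨i, hi, -⟩ := Finset.mem_image.1 hy
    exact ⟨i, by simpa using hi⟩
  · have h1 := h (fun i => decide (p i ≠ 0)) fun i => by
      constructor
      · intro h0; simp [h0]
      · intro h0; simp [h0]
    simpa [faceIndicators] using h1
  · rintro ⟨⟨i, hi⟩, hs⟩ v hv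
    refine K.down_closed hs (Finset.image_subset_image fun j hj => ?_)
      ⟨f i, Finset.mem_image_of_mem f ?_⟩
    · simp only [Finset.mem_filter, Finset.mem_univ, true_and] at hj ⊢
      intro h0
      simp [(hv j).1 h0] at hj
    · simpa using (hv i).2 hi

theorem isCompact_inducedCubicalComplex {V : Type*} [Finite V] (X : Set (V → Bool)) :
    IsCompact (inducedCubicalComplex X) := by
  have hcube : IsCompact (Set.univ.pi fun _ : V => Set.Icc (0 : ℝ) 1) :=
    isCompact_univ_pi fun _ => isCompact_Icc
  refine hcube.of_isClosed_subset ?_ fun p hp i _ => hp.1 i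
  have : inducedCubicalComplex X = (⋂ i, {p : V → ℝ | 0 ≤ p i ∧ p i ≤ 1}) ∩
      ⋂ v ∈ Xᶜ, ⋃ i, ({p : V → ℝ | p i = 0 ∧ v i = true} ∪ {p | p i = 1 ∧ v i = false}) := by
    ext p
    simp only [inducedCubicalComplex, Set.mem_ofPred_eq, Set.mem_inter_iff, Set.mem_iInter,
      Set.mem_iUnion, Set.mem_union, Set.mem_compl_iff]
    refine and_congr_right fun _ => forall_congr' fun v => ?_
    rw [← not_imp_not]
    refine imp_congr_right fun _ => ?_
    push Not
    refine exists_congr fun i => ?_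
    cases v i <;> simp
  rw [this]
  refine IsClosed.inter (isClosed_iInter fun i => ?_) (isClosed_biInter fun v _ =>
    isClosed_iUnion_of_finite fun i => IsClosed.union ?_ ?_)
  · exact (isClosed_le continuous_const (continuous_apply i)).inter
      (isClosed_le (continuous_apply i) continuous_const)
  · exact (isClosed_eq (continuous_apply i) continuous_const).inter isClosed_const
  · exact (isClosed_eq (continuous_apply i) continuous_const).inter isClosed_const

theorem mem_convexHull_image_iff {ι E : Type*} [Fintype ι] [DecidableEq E] [AddCommGroup E]
    [Module ℝ E] {f : ι → E} (hf : Function.Injective f) (t : Finset ι) (x : E) :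
    x ∈ convexHull ℝ (t.image f : Set E) ↔
      ∃ w : ι → ℝ, (∀ i, 0 ≤ w i) ∧ (∀ i ∉ t, w i = 0) ∧ ∑ i, w i = 1 ∧ ∑ i, w i • f i = x := by
  classical
  rw [Finset.mem_convexHull']
  constructor
  · rintro ⟨w, hw0, hw1, hwx⟩
    rw [Finset.sum_image hf.injOn] at hw1 hwx
    refine ⟨fun i => if i ∈ t then w (f i) else 0, fun i => ?_, fun i hi => if_neg hi, ?_, ?_⟩
    · dsimp only
      split_ifs with hi
      · exact hw0 _ (Finset.mem_image_of_mem f hi)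
      · exact le_rfl
    · simpa [Finset.sum_ite_mem] using hw1
    · simpa [ite_smul, Finset.sum_ite_mem] using hwx
  · rintro ⟨w, hw0, hwt, hw1, hwx⟩
    have hinv : ∀ i, Function.extend f w 0 (f i) = w i := fun i => hf.extend_apply w 0 i
    refine ⟨Function.extend f w 0, fun y hy => ?_, ?_, ?_⟩
    · obtain ⟨i, -, rfl⟩ := Finset.mem_image.1 hy
      exact hinv i ▸ hw0 i
    · rw [Finset.sum_image hf.injOn, ← hw1]
      simp only [hinv]
      exact Finset.sum_subset (Finset.subset_univ t) fun i _ hi => hwt i hi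
    · rw [Finset.sum_image hf.injOn, ← hwx]
      simp only [hinv]
      exact Finset.sum_subset (Finset.subset_univ t) fun i _ hi => by rw [hwt i hi, zero_smul]

theorem weights_eq_of_affineIndependent {ι E : Type*} [Fintype ι] [DecidableEq E] [AddCommGroup E]
    [Module ℝ E] {f : ι → E} (hf : Function.Injective f) {t : Finset ι}
    (ht : AffineIndependent ℝ ((↑) : t.image f → E)) {w c : ι → ℝ}
    (hwt : ∀ i ∉ t, w i = 0) (hct : ∀ i ∉ t, c i = 0) (hsum : ∑ i, w i = ∑ i, c i)
    (hx : ∑ i, w i • f i = ∑ i, c i • f i) : w = c := by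
  classical
  let g : t ↪ t.image f := ⟨fun i => ⟨f i, Finset.mem_image_of_mem f i.2⟩, fun i j h =>
    Subtype.ext (hf (congrArg Subtype.val h))⟩
  have hg := ht.comp_embedding g
  rw [affineIndependent_iff] at hg
  have key := hg Finset.univ (fun i => w i - c i) ?_ ?_
  · funext i
    by_cases hi : i ∈ t
    · exact sub_eq_zero.1 (key ⟨i, hi⟩ (Finset.mem_univ _))
    · rw [hwt i hi, hct i hi]
  · rw [Finset.sum_coe_sort t fun i => w i - c i, ← sub_eq_zero.2 hsum,
      ← Finset.sum_sub_distrib]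
    exact Finset.sum_subset (Finset.subset_univ t) fun i _ hi => by rw [hwt i hi, hct i hi, sub_zero]
  · change ∑ i : t, (w i - c i) • f i = 0
    rw [Finset.sum_coe_sort t fun i => (w i - c i) • f i, ← sub_eq_zero.2 hx,
      ← Finset.sum_sub_distrib]
    simp only [← sub_smul]
    exact Finset.sum_subset (Finset.subset_univ t) fun i _ hi => by
      rw [hwt i hi, hct i hi, sub_zero, zero_smul]

/-- Barycentric coordinates on the space of a simplicial complex are unique. -/
theorem barycentric_unique {n m : ℕ} {K : Geometry.SimplicialComplex ℝ (Fin n → ℝ)}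
    {f : Fin m → Fin n → ℝ} (hf : Function.Injective f) {w c : Fin m → ℝ}
    (hw0 : ∀ i, 0 ≤ w i) (hc0 : ∀ i, 0 ≤ c i)
    (hwK : (Finset.univ.filter fun i => w i ≠ 0).image f ∈ K.faces)
    (hcK : (Finset.univ.filter fun i => c i ≠ 0).image f ∈ K.faces)
    (hw1 : ∑ i, w i = 1) (hc1 : ∑ i, c i = 1)
    (hx : ∑ i, w i • f i = ∑ i, c i • f i) : w = c := by
  classical
  have hw := (mem_convexHull_image_iff hf (Finset.univ.filter fun i => w i ≠ 0) _).2
    ⟨w, hw0, by simp, hw1, rfl⟩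
  have hc := (mem_convexHull_image_iff hf (Finset.univ.filter fun i => c i ≠ 0) _).2
    ⟨c, hc0, by simp, hc1, rfl⟩
  rw [← hx] at hc
  have hwc := K.inter_subset_convexHull hwK hcK ⟨hw, hc⟩
  rw [← Finset.coe_inter, ← Finset.image_inter _ _ hf] at hwc
  obtain ⟨u, -, hut, hu1, hux⟩ := (mem_convexHull_image_iff hf _ _).1 hwc
  have hwu : w = u := weights_eq_of_affineIndependent hf (K.indep hwK) (by simp)
    (fun i hi => hut i fun h => hi (Finset.mem_inter.1 h).1) (hw1.trans hu1.symm) hux.symm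
  have hcu : c = u := weights_eq_of_affineIndependent hf (K.indep hcK) (by simp)
    (fun i hi => hut i fun h => hi (Finset.mem_inter.1 h).2) (hc1.trans hu1.symm)
    (hx.symm.trans hux.symm)
  exact hwu.trans hcu.symm

/-- The cubical subdivision of a finite simplicial complex is homeomorphic to its space. -/
theorem nonempty_homeomorph_space {n m : ℕ} (K : Geometry.SimplicialComplex ℝ (Fin n → ℝ))
    {f : Fin m → Fin n → ℝ} (hf : Function.Injective f) (hrange : K.vertices ⊆ Set.range f) :
    Nonempty (inducedCubicalComplex (faceIndicators K f) ≃ₜ K.space) := by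
  classical
  have hN := fun p => (mem_inducedCubicalComplex_faceIndicators (K := K) (f := f) (p := p)).1
  have hpos : ∀ p ∈ inducedCubicalComplex (faceIndicators K f), 0 < ∑ i, p i := fun p hp => by
    obtain ⟨hp01, ⟨j, hj⟩, -⟩ := hN p hp
    exact Finset.sum_pos' (fun i _ => (hp01 i).1) ⟨j, Finset.mem_univ j, hj ▸ one_pos⟩
  have hsupp : ∀ p ∈ inducedCubicalComplex (faceIndicators K f),
      (Finset.univ.filter fun i => (∑ k, p k)⁻¹ * p i ≠ 0) =
        Finset.univ.filter fun i => p i ≠ 0 := fun p hp => by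
    simp [(hpos p hp).ne']
  have hsum : ∀ p ∈ inducedCubicalComplex (faceIndicators K f),
      ∑ i, (∑ k, p k)⁻¹ * p i = 1 := fun p hp => by
    rw [← Finset.mul_sum, inv_mul_cancel₀ (hpos p hp).ne']
  have hnonneg : ∀ p ∈ inducedCubicalComplex (faceIndicators K f),
      ∀ i, 0 ≤ (∑ k, p k)⁻¹ * p i := fun p hp i =>
    mul_nonneg (inv_nonneg.2 (hpos p hp).le) ((hN p hp).1 i).1
  let F : inducedCubicalComplex (faceIndicators K f) → K.space := fun p =>
    ⟨∑ i, ((∑ k, p.1 k)⁻¹ * p.1 i) • f i, Geometry.SimplicialComplex.mem_space_iff.2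
      ⟨_, (hN p.1 p.2).2.2, (mem_convexHull_image_iff hf _ _).2
        ⟨_, hnonneg p.1 p.2, by simp +contextual, hsum p.1 p.2, rfl⟩⟩⟩
  have hF : Continuous F := by
    refine Continuous.subtype_mk (continuous_finsetSum _ fun i _ => ?_) _
    have hk : ∀ k, Continuous fun p : inducedCubicalComplex (faceIndicators K f) => p.1 k :=
      fun k => (continuous_apply k).comp continuous_subtype_val
    exact (((continuous_finsetSum _ fun k _ => hk k).inv₀ fun p => (hpos p.1 p.2).ne').mul
      (hk i)).smul continuous_const
  have hinj : Function.Injective F := by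
    rintro ⟨p, hp⟩ ⟨q, hq⟩ hpq
    have h := barycentric_unique (K := K) hf (hnonneg p hp) (hnonneg q hq)
      (by rw [hsupp p hp]; exact (hN p hp).2.2) (by rw [hsupp q hq]; exact (hN q hq).2.2)
      (hsum p hp) (hsum q hq) (congrArg Subtype.val hpq)
    have hP := hpos p hp
    have hQ := hpos q hq
    obtain ⟨hp01, ⟨j, hj⟩, -⟩ := hN p hp
    obtain ⟨hq01, ⟨k, hk⟩, -⟩ := hN q hq
    have hcross : ∀ i, p i * ∑ l, q l = q i * ∑ l, p l := fun i => by
      have := congrFun h i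
      field_simp at this
      linarith
    have hPQ : ∑ l, p l = ∑ l, q l := by
      have h1 := hcross j
      have h2 := hcross k
      rw [hj] at h1
      rw [hk] at h2
      nlinarith [(hq01 j).2, (hp01 k).2]
    exact Subtype.ext (funext fun i => mul_right_cancel₀ hQ.ne' ((hcross i).trans (by rw [hPQ])))
  have hsurj : Function.Surjective F := by
    rintro ⟨x, hx⟩
    obtain ⟨s, hs, hxs⟩ := Geometry.SimplicialComplex.mem_space_iff.1 hx
    have hst : (Finset.univ.filter fun i => f i ∈ s).image f = s := by
      ext y
      simp only [Finset.mem_image, Finset.mem_filter, Finset.mem_univ, true_and]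
      constructor
      · rintro ⟨i, hi, rfl⟩
        exact hi
      · intro hy
        obtain ⟨i, rfl⟩ := hrange (K.down_closed hs (Finset.singleton_subset_iff.2 hy)
          (Finset.singleton_nonempty y))
        exact ⟨i, hy, rfl⟩
    rw [← hst] at hxs
    obtain ⟨w, hw0, hwt, hw1, hwx⟩ := (mem_convexHull_image_iff hf _ _).1 hxs
    have hne : (Finset.univ : Finset (Fin m)).Nonempty := by
      rw [Finset.nonempty_iff_ne_empty]
      intro h0
      simp [h0] at hw1
    obtain ⟨j, -, hj⟩ := Finset.exists_max_image Finset.univ w hne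
    have hwj : 0 < w j := by
      by_contra hle
      have : ∑ i, w i ≤ 0 := Finset.sum_nonpos fun i hi => (hj i hi).trans (not_lt.1 hle)
      linarith
    have hp : (fun i => w i / w j) ∈ inducedCubicalComplex (faceIndicators K f) := by
      refine mem_inducedCubicalComplex_faceIndicators.2 ⟨fun i => ⟨div_nonneg (hw0 i) hwj.le,
        (div_le_one hwj).2 (hj i (Finset.mem_univ i))⟩, ⟨j, div_self hwj.ne'⟩,
        K.down_closed hs ?_ ⟨f j, Finset.mem_image_of_mem f (by simp [hwj.ne'])⟩⟩
      intro y hy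
      obtain ⟨i, hi, rfl⟩ := Finset.mem_image.1 hy
      by_contra hys
      have : w i = 0 := hwt i (by simpa using hys)
      simp [this] at hi
    refine ⟨⟨_, hp⟩, Subtype.ext ?_⟩
    change ∑ i, ((∑ k, w k / w j)⁻¹ * (w i / w j)) • f i = x
    rw [← hwx, ← Finset.sum_div, hw1]
    refine Finset.sum_congr rfl fun i _ => ?_
    congr 1
    field_simp
  have : CompactSpace (inducedCubicalComplex (faceIndicators K f)) :=
    isCompact_iff_compactSpace.1 (isCompact_inducedCubicalComplex _)
  exact ⟨Continuous.homeoOfEquivCompactToT2 (f := Equiv.ofBijective F ⟨hinj, hsurj⟩) hF⟩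

/-- Reindexing the coordinates of an induced cubical complex. -/
theorem nonempty_homeomorph_inducedCubicalComplex_reindex {V W : Type*} (e : W ≃ V)
    (X : Set (V → Bool)) :
    Nonempty (inducedCubicalComplex {x : W → Bool | x ∘ e.symm ∈ X} ≃ₜ
      inducedCubicalComplex X) := by
  refine ⟨(Homeomorph.piCongrLeft (Y := fun _ => ℝ) e).subtype fun p => ?_⟩
  have happ : ∀ i, Homeomorph.piCongrLeft (Y := fun _ => ℝ) e p (e i) = p i := fun i =>
    Equiv.piCongrLeft_apply_apply (fun _ => ℝ) e p i
  refine and_congr ?_ ⟨fun h v hv => ?_, fun h v hv => h _ ?_⟩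
  · rw [← e.forall_congr_right]
    simp only [happ]
  · have := h (v ∘ e) fun i => by
      simpa only [happ, Function.comp_apply] using hv (e i)
    simpa [Function.comp_assoc] using this
  · rw [← e.forall_congr_right]
    simpa only [happ, Function.comp_apply, Equiv.symm_apply_apply] using hv

/-- The 3-CNF formula whose auxiliary variables `(v, k)` with `v ∉ X` are implied by agreement of
the first `k` variables with `v`, and which forbids full agreement. -/
def prefixCNF {m : ℕ} (X : Set (Fin m → Bool)) :
    Set (Finset ((Fin m ⊕ (Fin m → Bool) × Fin (m + 1)) × Bool)) :=
  {C | ∃ v ∉ X, C = {(Sum.inr (v, 0), true)} ∨ C = {(Sum.inr (v, Fin.last m), false)} ∨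
    ∃ k : Fin m, C = {(Sum.inr (v, k.castSucc), false), (Sum.inl k, !v k),
      (Sum.inr (v, k.succ), true)}}

theorem exists_extension_satisfying_prefixCNF_iff {m : ℕ} (X : Set (Fin m → Bool))
    (x : Fin m → Bool) :
    (∃ y : (Fin m → Bool) × Fin (m + 1) → Bool, ∀ C ∈ prefixCNF X,
      ∃ l ∈ C, Sum.elim x y l.1 = l.2) ↔ x ∈ X := by
  classical
  constructor
  · rintro ⟨y, hy⟩
    by_contra hx
    have hall : ∀ k, y (x, k) = true := by
      intro k
      induction k using Fin.induction with
      | zero => simpa using hy _ ⟨x, hx, Or.inl rfl⟩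
      | succ k ih => simpa [ih] using hy _ ⟨x, hx, Or.inr (Or.inr ⟨k, rfl⟩)⟩
    simpa [hall] using hy _ ⟨x, hx, Or.inr (Or.inl rfl)⟩
  · intro hx
    refine ⟨fun a => decide (∀ j : Fin m, j.castSucc < a.2 → x j = a.1 j), ?_⟩
    rintro C ⟨v, hv, rfl | rfl | ⟨k, rfl⟩⟩
    · simp
    · have hne : ∃ j, x j ≠ v j := by
        by_contra! h
        exact hv (funext h ▸ hx)
      simpa [Fin.castSucc_lt_last] using hne
    · by_cases hk : x k = v k
      · by_cases hpre : ∀ j : Fin m, j.castSucc < k.castSucc → x j = v j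
        · refine ⟨(Sum.inr (v, k.succ), true), by simp, ?_⟩
          simp only [Sum.elim_inr, decide_eq_true_eq]
          intro j hj
          rcases (Fin.castSucc_lt_succ_iff.1 hj).lt_or_eq with h | rfl
          · exact hpre j h
          · exact hk
        · exact ⟨(Sum.inr (v, k.castSucc), false), by simp, by simpa using hpre⟩
      · refine ⟨(Sum.inl k, !v k), by simp, ?_⟩
        cases hxk : x k <;> cases hvk : v k <;> simp_all

/-- Every set of Boolean vectors is a projection of the solution space of a 3-CNF formula. -/
theorem exists_threeCNF_proj_eq {m : ℕ} (X : Set (Fin m → Bool)) :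
    ∃ (d : ℕ) (Φ : Finset (Finset (Fin d × Bool))) (D : Set (Fin d)) (e : {i // i ∉ D} ≃ Fin m),
      (∀ C ∈ Φ, C.card ≤ 3) ∧ proj D '' cnfDisc Φ = {x | x ∘ e.symm ∈ X} := by
  classical
  let g : (Fin m ⊕ (Fin m → Bool) × Fin (m + 1)) ≃ Fin _ := Fintype.equivFin _
  let D : Set (Fin _) := {i | (g.symm i).isRight}
  let e : Fin m ≃ {i // i ∉ D} := Equiv.ofBijective
    (fun k => ⟨g (Sum.inl k), by simp [D]⟩) ⟨fun a b h => by simpa using h, fun ⟨i, hi⟩ => by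
      obtain ⟨a, rfl⟩ := g.surjective i
      rcases a with k | a
      · exact ⟨k, rfl⟩
      · simp [D] at hi⟩
  refine ⟨_, (prefixCNF X).toFinite.toFinset.image
    (Finset.image (Prod.map g (id : Bool → Bool))), D, e.symm, ?_, ?_⟩
  · intro C hC
    obtain ⟨C, hCX, rfl⟩ := Finset.mem_image.1 hC
    refine Finset.card_image_le.trans ?_
    obtain ⟨v, -, rfl | rfl | ⟨k, rfl⟩⟩ := (Set.Finite.mem_toFinset _).1 hCX
    · simp
    · simp
    · exact Finset.card_le_three
  · have hdisc : ∀ z : Fin _ → Bool, z ∈ cnfDisc ((prefixCNF X).toFinite.toFinset.image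
        (Finset.image (Prod.map g (id : Bool → Bool)))) ↔
        ∀ C ∈ prefixCNF X, ∃ l ∈ C, (z ∘ g) l.1 = l.2 := fun z => by
      simp only [cnfDisc, Set.mem_ofPred_eq, Finset.forall_mem_image, Finset.exists_mem_image,
        Set.Finite.mem_toFinset, Prod.map_fst, Prod.map_snd, id, Function.comp_apply]
    ext x
    rw [Set.mem_ofPred_eq, ← exists_extension_satisfying_prefixCNF_iff]
    constructor
    · rintro ⟨z, hz, rfl⟩
      refine ⟨fun a => z (g (Sum.inr a)), ?_⟩
      convert (hdisc z).1 hz using 5 with C hC l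
      rcases l with ⟨k | a, b⟩ <;> rfl
    · rintro ⟨y, hy⟩
      refine ⟨Sum.elim (x ∘ e) y ∘ g.symm, (hdisc _).2 ?_, ?_⟩
      · simpa [Function.comp_assoc] using hy
      · funext i
        obtain ⟨k, rfl⟩ := e.surjective i
        change Sum.elim (x ∘ e) y (g.symm (g (Sum.inl k))) = x (e k)
        rw [Equiv.symm_apply_apply]
        rfl

/-- 3-SAT is projection-universal for finite simplicial complexes. -/
theorem threeSat_projection_universal
    (n : ℕ) (K : Geometry.SimplicialComplex ℝ (Fin n → ℝ)) (hK : K.faces.Finite) :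
    ∃ (d : ℕ) (Φ : Finset (Finset (Fin d × Bool))) (D : Set (Fin d)),
      (∀ C ∈ Φ, C.card ≤ 3) ∧
      Nonempty ((inducedCubicalComplex (proj D '' cnfDisc Φ)) ≃ₜ K.space) := by
  have hfin : K.vertices.Finite := by
    rw [K.vertices_eq]
    exact hK.biUnion fun s _ => s.finite_toSet
  have := hfin.to_subtype
  let f : Fin (Nat.card K.vertices) → Fin n → ℝ := fun i => ((Finite.equivFin K.vertices).symm i).1
  have hf : Function.Injective f := Subtype.val_injective.comp (Equiv.injective _)
  have hrange : K.vertices ⊆ Set.range f := fun x hx =>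
    ⟨Finite.equivFin K.vertices ⟨x, hx⟩, congrArg Subtype.val (Equiv.symm_apply_apply _ _)⟩
  obtain ⟨d, Φ, D, e, hcard, hproj⟩ := exists_threeCNF_proj_eq (faceIndicators K f)
  obtain ⟨h₁⟩ := nonempty_homeomorph_inducedCubicalComplex_reindex e (faceIndicators K f)
  obtain ⟨h₂⟩ := nonempty_homeomorph_space K hf hrange
  exact ⟨d, Φ, D, hcard, hproj ▸ ⟨h₁.trans h₂⟩⟩
end

section
/- 3-SAT is homotopy-universal for finite simplicial complexes: for every geometric simplicial complex K in a Euclidean space (Fin n → ℝ) with finitely many faces, there exist a natural number d and a CNF formula Φ over Fin d, each of whose clauses has at most 3 literals, such that the induced cubical complex N(disc(Φ)) is homotopy equivalent to the underlying space |K| of K. -/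
/-- A clause holds at a point of the cube if the point lies on the facet of one of its literals. -/
def ClauseHolds {V : Type*} (C : Finset (V × Bool)) (p : V → ℝ) : Prop :=
  ∃ l ∈ C, p l.1 = l.2.toNat

/-- The points of the cube at which every clause of a CNF formula holds. -/
def cnfComplex {V : Type*} (Φ : Finset (Finset (V × Bool))) : Set (V → ℝ) :=
  {p | (∀ i, p i ∈ Set.Icc (0 : ℝ) 1) ∧ ∀ C ∈ Φ, ClauseHolds C p}

/-- No clause contains a literal together with its negation. -/
def NonTautological {V : Type*} (Φ : Finset (Finset (V × Bool))) : Prop :=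
  ∀ C ∈ Φ, ∀ i, (i, true) ∈ C → (i, false) ∉ C

theorem inducedCubicalComplex_cnfDisc {V : Type*} {Φ : Finset (Finset (V × Bool))}
    (hΦ : NonTautological Φ) : inducedCubicalComplex (cnfDisc Φ) = cnfComplex Φ := by
  classical
  ext p
  refine and_congr_right fun _ => ⟨fun h C hC => ?_, fun h v hv C hC => ?_⟩
  · obtain ⟨⟨i, b⟩, hl, hb⟩ := h (fun i => if p i = 1 then true else if p i = 0 then false else
      decide ((i, false) ∈ C)) (fun i => ⟨fun h => by simp [h], fun h => by simp [h]⟩) C hC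
    refine ⟨(i, b), hl, ?_⟩
    have htaut := hΦ C hC i
    dsimp only at hb ⊢
    split_ifs at hb with h1 h0
    · simp [← hb, h1]
    · simp [← hb, h0]
    · cases b <;> simp_all
  · obtain ⟨⟨i, b⟩, hl, hb⟩ := h C hC
    refine ⟨(i, b), hl, ?_⟩
    cases b
    · exact (hv i).1 (by simpa using hb)
    · exact (hv i).2 (by simpa using hb)

/-- Maps into a set are homotopic if the segments between their values stay in the set. -/
theorem ContinuousMap.homotopic_of_segment_subset {X E : Type*} [TopologicalSpace X]
    [AddCommGroup E] [Module ℝ E] [TopologicalSpace E] [IsTopologicalAddGroup E]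
    [ContinuousSMul ℝ E] {S : Set E} (f g : C(X, S))
    (h : ∀ x, segment ℝ (f x : E) (g x) ⊆ S) : f.Homotopic g :=
  ⟨{ toFun := fun q => ⟨AffineMap.lineMap (f q.2 : E) (g q.2 : E) (q.1 : ℝ), h q.2 (by
        rw [segment_eq_image_lineMap]
        exact ⟨q.1, q.1.2, rfl⟩)⟩
     continuous_toFun := by
        refine Continuous.subtype_mk ?_ _
        simp only [AffineMap.lineMap_apply_module]
        fun_prop
     map_zero_left := fun x => by simp
     map_one_left := fun x => by simp }⟩

theorem eq_of_mem_segment {V : Type*} {p q x : V → ℝ} (hx : x ∈ segment ℝ p q) {i : V} {c : ℝ}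
    (hp : p i = c) (hq : q i = c) : x i = c := by
  obtain ⟨a, b, _, _, hab, rfl⟩ := hx
  simp [hp, hq, ← add_mul, hab]

theorem mem_Icc_of_mem_segment {V : Type*} {p q x : V → ℝ} (hx : x ∈ segment ℝ p q) {i : V}
    (hp : p i ∈ Set.Icc (0 : ℝ) 1) (hq : q i ∈ Set.Icc (0 : ℝ) 1) : x i ∈ Set.Icc (0 : ℝ) 1 := by
  obtain ⟨a, b, ha, hb, hab, rfl⟩ := hx
  exact convex_Icc (0 : ℝ) 1 hp hq ha hb hab

/-- Truncation of a real number to the unit interval. -/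
noncomputable def clampUnit (x : ℝ) : ℝ := max 0 (min 1 x)

theorem continuous_clampUnit : Continuous clampUnit := by
  unfold clampUnit
  fun_prop

theorem clampUnit_mem (x : ℝ) : clampUnit x ∈ Set.Icc (0 : ℝ) 1 :=
  ⟨le_max_left _ _, max_le zero_le_one (min_le_left _ _)⟩

theorem clampUnit_of_nonpos {x : ℝ} (h : x ≤ 0) : clampUnit x = 0 :=
  max_eq_left ((min_le_right _ _).trans h)

theorem clampUnit_of_one_le {x : ℝ} (h : 1 ≤ x) : clampUnit x = 1 := by
  simp [clampUnit, min_eq_left h]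

/-- The self-map of the cube that collapses a collar of every facet onto that facet. -/
noncomputable def collarCollapse {V : Type*} (p : V → ℝ) : V → ℝ :=
  fun i => clampUnit (2 * p i - 1 / 2)

theorem continuous_collarCollapse {V : Type*} :
    Continuous (collarCollapse : (V → ℝ) → V → ℝ) :=
  continuous_pi fun i => continuous_clampUnit.comp (by fun_prop)

theorem collarCollapse_eq {V : Type*} {p : V → ℝ} {i : V} {b : Bool}
    (h : |p i - b.toNat| ≤ 1 / 4) : collarCollapse p i = b.toNat := by
  rw [abs_le] at h
  cases b
  · simp only [Bool.toNat_false, Nat.cast_zero] at h ⊢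
    exact clampUnit_of_nonpos (by linarith)
  · simp only [Bool.toNat_true, Nat.cast_one] at h ⊢
    exact clampUnit_of_one_le (by linarith)

theorem segment_collarCollapse_subset {V : Type*} {Φ : Finset (Finset (V × Bool))} {p : V → ℝ}
    (hp : p ∈ cnfComplex Φ) : segment ℝ p (collarCollapse p) ⊆ cnfComplex Φ := fun x hx =>
  ⟨fun i => mem_Icc_of_mem_segment hx (hp.1 i) (clampUnit_mem _), fun C hC =>
    let ⟨l, hl, h⟩ := hp.2 C hC
    ⟨l, hl, eq_of_mem_segment hx h (collarCollapse_eq (by rw [h]; norm_num))⟩⟩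

theorem collarCollapse_mem {V : Type*} {Φ : Finset (Finset (V × Bool))} {p : V → ℝ}
    (hp : p ∈ cnfComplex Φ) : collarCollapse p ∈ cnfComplex Φ :=
  segment_collarCollapse_subset hp (right_mem_segment ℝ _ _)

/-- The distance of a point from the union of the facets of the literals of a clause. -/
noncomputable def clauseDist {V : Type*} (C : Finset (V × Bool)) (hC : C.Nonempty)
    (p : V → ℝ) : ℝ :=
  C.inf' hC fun l => |p l.1 - l.2.toNat|

theorem continuous_clauseDist {V : Type*} (C : Finset (V × Bool)) (hC : C.Nonempty) :
    Continuous (clauseDist C hC) :=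
  Continuous.finset_inf'_apply hC fun l _ => by fun_prop

theorem ClauseHolds.clauseDist_le {V : Type*} {C : Finset (V × Bool)} {p : V → ℝ}
    (h : ClauseHolds C p) (hC : C.Nonempty) : clauseDist C hC p ≤ 0 := by
  obtain ⟨l, hl, h⟩ := h
  exact (Finset.inf'_le _ hl).trans (by simp [h])

theorem clauseHolds_collarCollapse {V : Type*} {C : Finset (V × Bool)} {hC : C.Nonempty}
    {p : V → ℝ} (h : clauseDist C hC p ≤ 1 / 4) : ClauseHolds C (collarCollapse p) := by
  obtain ⟨l, hl, hl'⟩ := Finset.exists_mem_eq_inf' hC fun l : V × Bool => |p l.1 - l.2.toNat|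
  exact ⟨l, hl, collarCollapse_eq (hl' ▸ h)⟩

/-- Literals over `Fin d` regarded as literals over `Fin (d + 1)`, leaving the variable `0` free. -/
def liftLiteral {d : ℕ} : Fin d × Bool ↪ Fin (d + 1) × Bool :=
  (Fin.succEmb d).prodMap (Function.Embedding.refl Bool)

/-- Clauses over `Fin d` regarded as clauses over `Fin (d + 1)`. -/
def liftClause {d : ℕ} : Finset (Fin d × Bool) ↪ Finset (Fin (d + 1) × Bool) :=
  Finset.mapEmbedding liftLiteral |>.toEmbedding

theorem mem_liftClause {d : ℕ} {C : Finset (Fin d × Bool)} {i : Fin (d + 1)} {b : Bool} :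
    (i, b) ∈ liftClause C ↔ ∃ j, (j, b) ∈ C ∧ j.succ = i := by
  simp [liftClause, liftLiteral]

theorem card_liftClause {d : ℕ} (C : Finset (Fin d × Bool)) : (liftClause C).card = C.card :=
  Finset.card_map _

theorem clauseHolds_liftClause {d : ℕ} {C : Finset (Fin d × Bool)} {p : Fin (d + 1) → ℝ} :
    ClauseHolds (liftClause C) p ↔ ClauseHolds C fun i => p i.succ := by
  simp only [ClauseHolds, Prod.exists, mem_liftClause]
  constructor
  · rintro ⟨_, b, ⟨j, hj, rfl⟩, h⟩
    exact ⟨j, b, hj, h⟩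
  · rintro ⟨j, b, hj, h⟩
    exact ⟨j.succ, b, ⟨j, hj, rfl⟩, h⟩

theorem clauseHolds_insert {V : Type*} [DecidableEq V] {C : Finset (V × Bool)} {p : V → ℝ} {i : V}
    {b : Bool} :
    ClauseHolds (insert (i, b) C) p ↔ p i = b.toNat ∨ ClauseHolds C p := by
  simp [ClauseHolds]

theorem clauseHolds_union {V : Type*} [DecidableEq V] {A B : Finset (V × Bool)} {p : V → ℝ} :
    ClauseHolds (A ∪ B) p ↔ ClauseHolds A p ∨ ClauseHolds B p := by
  simp only [ClauseHolds, Finset.mem_union, or_and_right, exists_or]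

/-- The formula `Φ ∧ (A ∨ y) ∧ (B ∨ ¬ y)`, where `y` is a new variable. -/
def splitClause {d : ℕ} (Φ : Finset (Finset (Fin d × Bool))) (A B : Finset (Fin d × Bool)) :
    Finset (Finset (Fin (d + 1) × Bool)) :=
  insert (insert (0, true) (liftClause A))
    (insert (insert (0, false) (liftClause B)) (Φ.map liftClause))

theorem mem_cnfComplex_splitClause {d : ℕ} {Φ : Finset (Finset (Fin d × Bool))}
    {A B : Finset (Fin d × Bool)} {p : Fin (d + 1) → ℝ} :
    p ∈ cnfComplex (splitClause Φ A B) ↔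
      p 0 ∈ Set.Icc (0 : ℝ) 1 ∧ (fun i : Fin d => p i.succ) ∈ cnfComplex Φ ∧
      (p 0 = 1 ∨ ClauseHolds A fun i => p i.succ) ∧
      (p 0 = 0 ∨ ClauseHolds B fun i => p i.succ) := by
  simp only [cnfComplex, splitClause, Set.mem_ofPred_eq, Finset.forall_mem_insert,
    Finset.forall_mem_map, clauseHolds_insert, clauseHolds_liftClause, Fin.forall_fin_succ,
    Bool.toNat_true, Bool.toNat_false, Nat.cast_one, Nat.cast_zero]
  tauto

theorem segment_subset_cnfComplex_splitClause {d : ℕ} {Φ : Finset (Finset (Fin d × Bool))}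
    {A B : Finset (Fin d × Bool)} {p q : Fin (d + 1) → ℝ}
    (hp : p ∈ cnfComplex (splitClause Φ A B)) (hq : q ∈ cnfComplex (splitClause Φ A B))
    (hpq : ∀ i : Fin d, p i.succ = q i.succ) :
    segment ℝ p q ⊆ cnfComplex (splitClause Φ A B) := by
  intro x hx
  have hxq : (fun i : Fin d => x i.succ) = fun i => q i.succ :=
    funext fun i => eq_of_mem_segment hx (hpq i) rfl
  have hpq' : (fun i : Fin d => p i.succ) = fun i => q i.succ := funext hpq
  rw [mem_cnfComplex_splitClause] at *
  rw [hpq'] at hp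
  rw [hxq]
  refine ⟨mem_Icc_of_mem_segment hx hp.1 hq.1, hq.2.1, ?_, ?_⟩
  · exact or_iff_not_imp_right.2 fun h =>
      eq_of_mem_segment hx (hp.2.2.1.resolve_right h) (hq.2.2.1.resolve_right h)
  · exact or_iff_not_imp_right.2 fun h =>
      eq_of_mem_segment hx (hp.2.2.2.resolve_right h) (hq.2.2.2.resolve_right h)

/-- A homotopy section of the projection forgetting the variable introduced by `splitClause`. -/
noncomputable def splitSection {d : ℕ} (A B : Finset (Fin d × Bool)) (hA : A.Nonempty)
    (hB : B.Nonempty) (p : Fin d → ℝ) : Fin (d + 1) → ℝ :=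
  Fin.cons (clampUnit (2 * (clauseDist A hA p - clauseDist B hB p) + 1 / 2)) (collarCollapse p)

theorem splitSection_mem {d : ℕ} {Φ : Finset (Finset (Fin d × Bool))}
    {A B : Finset (Fin d × Bool)} (hA : A.Nonempty) (hB : B.Nonempty) {p : Fin d → ℝ}
    (hp : p ∈ cnfComplex (insert (A ∪ B) Φ)) :
    splitSection A B hA hB p ∈ cnfComplex (splitClause Φ A B) := by
  have hAB := clauseHolds_union.1 (hp.2 _ (Finset.mem_insert_self _ _))
  have hΦ : p ∈ cnfComplex Φ := ⟨hp.1, fun C hC => hp.2 C (Finset.mem_insert_of_mem hC)⟩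
  simp only [mem_cnfComplex_splitClause, splitSection, Fin.cons_zero, Fin.cons_succ]
  refine ⟨clampUnit_mem _, collarCollapse_mem hΦ, ?_, ?_⟩
  · by_cases h : clauseDist A hA p ≤ 1 / 4
    · exact .inr (clauseHolds_collarCollapse h)
    · have hB' : ClauseHolds B p := hAB.resolve_left fun h' => by
        linarith [h'.clauseDist_le hA]
      exact .inl (clampUnit_of_one_le (by linarith [hB'.clauseDist_le hB]))
  · by_cases h : clauseDist B hB p ≤ 1 / 4
    · exact .inr (clauseHolds_collarCollapse h)
    · have hA' : ClauseHolds A p := hAB.resolve_right fun h' => by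
        linarith [h'.clauseDist_le hB]
      exact .inl (clampUnit_of_nonpos (by linarith [hA'.clauseDist_le hA]))

/-- Splitting a clause by means of a new variable does not change the homotopy type. -/
theorem nonempty_homotopyEquiv_splitClause {d : ℕ} (Φ : Finset (Finset (Fin d × Bool)))
    {A B : Finset (Fin d × Bool)} (hA : A.Nonempty) (hB : B.Nonempty) :
    Nonempty (ContinuousMap.HomotopyEquiv (cnfComplex (splitClause Φ A B))
      (cnfComplex (insert (A ∪ B) Φ))) := by
  have hproj : ∀ p ∈ cnfComplex (splitClause Φ A B),
      (fun i : Fin d => p i.succ) ∈ cnfComplex (insert (A ∪ B) Φ) := by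
    intro p hp
    obtain ⟨-, hΦ, h1, h0⟩ := mem_cnfComplex_splitClause.1 hp
    refine ⟨hΦ.1, Finset.forall_mem_insert _ _ _ |>.2 ⟨clauseHolds_union.2 ?_, hΦ.2⟩⟩
    refine h1.symm.imp_right fun h => h0.resolve_left ?_
    simp [h]
  let proj : C(cnfComplex (splitClause Φ A B), cnfComplex (insert (A ∪ B) Φ)) :=
    ⟨fun p => ⟨fun i => p.1 i.succ, hproj p p.2⟩, Continuous.subtype_mk (continuous_pi fun i =>
      (continuous_apply i.succ).comp continuous_subtype_val) _⟩
  let sec : C(cnfComplex (insert (A ∪ B) Φ), cnfComplex (splitClause Φ A B)) :=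
    ⟨fun p => ⟨splitSection A B hA hB p, splitSection_mem hA hB p.2⟩, by
      refine Continuous.subtype_mk ?_ _
      refine Continuous.comp (g := splitSection A B hA hB) ?_ continuous_subtype_val
      have hdA := continuous_clauseDist A hA
      have hdB := continuous_clauseDist B hB
      have hcol := continuous_collarCollapse (V := Fin d)
      have hclamp := continuous_clampUnit
      refine continuous_pi fun i => Fin.cases ?_ (fun j => ?_) i
      · simp only [splitSection, Fin.cons_zero]
        fun_prop
      · simp only [splitSection, Fin.cons_succ]
        fun_prop⟩
  let col : C(cnfComplex (splitClause Φ A B), cnfComplex (splitClause Φ A B)) :=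
    ⟨fun p => ⟨collarCollapse p.1, collarCollapse_mem p.2⟩,
      (continuous_collarCollapse.comp continuous_subtype_val).subtype_mk _⟩
  refine ⟨⟨proj, sec, ?_, ?_⟩⟩
  · refine ContinuousMap.Homotopic.trans (g := col) ?_ ?_
    · refine ContinuousMap.homotopic_of_segment_subset _ _ fun p => ?_
      exact segment_subset_cnfComplex_splitClause (sec (proj p)).2 (col p).2 fun i => rfl
    · exact (ContinuousMap.homotopic_of_segment_subset _ _ fun p =>
        segment_collarCollapse_subset p.2).symm
  · exact (ContinuousMap.homotopic_of_segment_subset _ _ fun p =>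
      segment_collarCollapse_subset p.2).symm

theorem NonTautological.splitClause {d : ℕ} {Φ : Finset (Finset (Fin d × Bool))}
    {A B : Finset (Fin d × Bool)} (h : NonTautological (insert (A ∪ B) Φ)) :
    NonTautological (splitClause Φ A B) := by
  unfold NonTautological _root_.splitClause at *
  rw [Finset.forall_mem_insert] at h
  rw [Finset.forall_mem_insert, Finset.forall_mem_insert, Finset.forall_mem_map]
  simp only [Fin.forall_fin_succ, Finset.mem_insert, mem_liftClause, Finset.mem_union,
    Prod.mk.injEq, Fin.succ_inj, exists_eq_right, Fin.succ_ne_zero] at h ⊢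
  grind

/-- The total number of literals by which the clauses of a formula exceed three literals. -/
def clauseExcess {d : ℕ} (Φ : Finset (Finset (Fin d × Bool))) : ℕ := ∑ C ∈ Φ, (C.card - 3)

theorem clauseExcess_insert_le {d : ℕ} (Φ : Finset (Finset (Fin d × Bool)))
    (C : Finset (Fin d × Bool)) :
    clauseExcess (insert C Φ) ≤ (C.card - 3) + clauseExcess Φ := by
  by_cases h : C ∈ Φ
  · simp [Finset.insert_eq_of_mem h]
  · exact (Finset.sum_insert h).le

/-- Every formula can be replaced by a formula with clauses of at most three literals without
changing the homotopy type of its complex. -/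
theorem exists_threeSat_homotopyEquiv {d : ℕ} (Φ : Finset (Finset (Fin d × Bool)))
    (hΦ : NonTautological Φ) :
    ∃ (e : ℕ) (Ψ : Finset (Finset (Fin e × Bool))), NonTautological Ψ ∧
      (∀ C ∈ Ψ, C.card ≤ 3) ∧
      Nonempty (ContinuousMap.HomotopyEquiv (cnfComplex Ψ) (cnfComplex Φ)) := by
  induction hm : clauseExcess Φ using Nat.strong_induction_on generalizing d with
  | _ m ih =>
  by_cases hcard : ∀ C ∈ Φ, C.card ≤ 3
  · exact ⟨d, Φ, hΦ, hcard, ⟨.refl _⟩⟩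
  push Not at hcard
  obtain ⟨C, hC, hC3⟩ := hcard
  obtain ⟨A, hAC, hA2⟩ := Finset.exists_subset_card_eq (show 2 ≤ C.card by omega)
  have hB : (C \ A).card = C.card - 2 := by rw [Finset.card_sdiff_of_subset hAC, hA2]
  have hΦ' : insert (A ∪ (C \ A)) (Φ.erase C) = Φ := by
    rw [Finset.union_sdiff_of_subset hAC, Finset.insert_erase hC]
  have hlt : clauseExcess (splitClause (Φ.erase C) A (C \ A)) < m := by
    have h1 := clauseExcess_insert_le (insert (insert (0, false) (liftClause (C \ A)))
      ((Φ.erase C).map liftClause)) (insert (0, true) (liftClause A))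
    have h2 := clauseExcess_insert_le ((Φ.erase C).map liftClause)
      (insert (0, false) (liftClause (C \ A)))
    have h3 : clauseExcess ((Φ.erase C).map liftClause) = clauseExcess (Φ.erase C) := by
      simp only [clauseExcess, Finset.sum_map, card_liftClause]
    have h4 : clauseExcess (Φ.erase C) + (C.card - 3) = m := by
      rw [← hm]
      exact Finset.sum_erase_add _ _ hC
    have hcA := Finset.card_insert_le (0, true) (liftClause A)
    have hcB := Finset.card_insert_le (0, false) (liftClause (C \ A))
    rw [card_liftClause] at hcA hcB
    unfold splitClause
    omega
  obtain ⟨e, Ψ, hΨ, hΨ3, ⟨f⟩⟩ := ih _ hlt _ (NonTautological.splitClause (hΦ'.symm ▸ hΦ)) rfl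
  obtain ⟨g⟩ := nonempty_homotopyEquiv_splitClause (Φ.erase C) (A := A) (B := C \ A)
    (Finset.card_pos.1 (by omega)) (Finset.card_pos.1 (by omega))
  rw [hΦ'] at g
  exact ⟨e, Ψ, hΨ, hΨ3, ⟨f.trans g⟩⟩
/-- A formula over the vertices of a simplicial complex whose satisfying assignments are the
indicator functions of the faces. -/
noncomputable def faceFormula {E : Type*} [AddCommGroup E] [Module ℝ E]
    (K : Geometry.SimplicialComplex ℝ E) {d : ℕ} (v : Fin d ↪ E) :
    Finset (Finset (Fin d × Bool)) :=
  open Classical in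
  insert (Finset.univ.image fun i => (i, true))
    ((Finset.univ.filter fun σ : Finset (Fin d) => σ.Nonempty ∧ σ.map v ∉ K.faces).image
      fun σ => σ.image fun i => (i, false))

theorem nonTautological_faceFormula {E : Type*} [AddCommGroup E] [Module ℝ E]
    (K : Geometry.SimplicialComplex ℝ E) {d : ℕ} (v : Fin d ↪ E) :
    NonTautological (faceFormula K v) := by
  classical
  simp only [NonTautological, faceFormula, Finset.forall_mem_insert, Finset.forall_mem_image]
  simp

theorem mem_cnfComplex_faceFormula {E : Type*} [AddCommGroup E] [Module ℝ E]
    {K : Geometry.SimplicialComplex ℝ E} {d : ℕ} {v : Fin d ↪ E} {p : Fin d → ℝ} :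
    p ∈ cnfComplex (faceFormula K v) ↔ (∀ i, p i ∈ Set.Icc (0 : ℝ) 1) ∧ (∃ i, p i = 1) ∧
      (Finset.univ.filter fun i => p i ≠ 0).map v ∈ K.faces := by
  classical
  have h : p ∈ cnfComplex (faceFormula K v) ↔ (∀ i, p i ∈ Set.Icc (0 : ℝ) 1) ∧ (∃ i, p i = 1) ∧
      ∀ σ : Finset (Fin d), σ.Nonempty → σ.map v ∉ K.faces → ∃ i ∈ σ, p i = 0 := by
    simp only [cnfComplex, faceFormula, Set.mem_ofPred_eq, Finset.forall_mem_insert,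
      Finset.forall_mem_image]
    simp [ClauseHolds]
  rw [h]
  refine and_congr_right fun _ => and_congr_right fun ⟨i, hi⟩ => ⟨fun h => ?_, fun h σ hσ hσK => ?_⟩
  · by_contra hK
    obtain ⟨j, hj, hj0⟩ := h _ ⟨i, by simp [hi]⟩ hK
    exact (Finset.mem_filter.1 hj).2 hj0
  · by_contra! h0
    exact hσK (K.down_closed h (Finset.map_subset_map.2 fun j hj => by simpa using h0 j hj)
      hσ.map)

theorem mem_convexHull_map_iff {E : Type*} [AddCommGroup E] [Module ℝ E] {d : ℕ} {v : Fin d ↪ E}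
    {σ : Finset (Fin d)} {x : E} :
    x ∈ convexHull ℝ (σ.map v : Set E) ↔ ∃ w : Fin d → ℝ, (∀ i, 0 ≤ w i) ∧ (∀ i ∉ σ, w i = 0) ∧
      ∑ i, w i = 1 ∧ ∑ i, w i • v i = x := by
  classical
  rw [Finset.mem_convexHull']
  simp only [Finset.forall_mem_map, Finset.sum_map]
  constructor
  · rintro ⟨w, hw, h1, hx⟩
    refine ⟨fun i => if i ∈ σ then w (v i) else 0, fun i => ?_, fun i hi => if_neg hi, ?_, ?_⟩
    · dsimp only
      split_ifs with hi
      exacts [hw i hi, le_rfl]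
    · simpa using h1
    · simpa [ite_smul] using hx
  · rintro ⟨w, hw, h0, h1, hx⟩
    refine ⟨Function.extend v w 0, ?_⟩
    simp only [v.injective.extend_apply]
    refine ⟨fun i _ => hw i, ?_, ?_⟩
    · rw [← h1]
      exact Finset.sum_subset (Finset.subset_univ _) fun i _ hi => h0 i hi
    · rw [← hx]
      exact Finset.sum_subset (Finset.subset_univ _) fun i _ hi => by simp [h0 i hi]

/-- Barycentric coordinates with respect to a face are unique. -/
theorem barycentric_unique_s5 {E : Type*} [AddCommGroup E] [Module ℝ E]
    {K : Geometry.SimplicialComplex ℝ E} {d : ℕ} {v : Fin d ↪ E} {σ : Finset (Fin d)}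
    (hσ : σ.map v ∈ K.faces) {w w' : Fin d → ℝ} (hw : ∀ i ∉ σ, w i = 0) (hw' : ∀ i ∉ σ, w' i = 0)
    (h1 : ∑ i, w i = ∑ i, w' i) (hx : ∑ i, w i • v i = ∑ i, w' i • v i) : w = w' := by
  have hind : AffineIndependent ℝ fun i : σ => v i :=
    (K.indep hσ).comp_embedding
      ⟨fun i : σ => (⟨v i, Finset.mem_map_of_mem v i.2⟩ : (σ.map v : Finset E)), fun i j hij =>
        Subtype.ext (v.injective (congrArg Subtype.val hij))⟩
  have h := affineIndependent_iff.1 hind Finset.univ (fun i => w i - w' i) ?_ ?_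
  · funext i
    by_cases hi : i ∈ σ
    · exact sub_eq_zero.1 (h ⟨i, hi⟩ (Finset.mem_univ _))
    · rw [hw i hi, hw' i hi]
  · rw [Finset.sum_coe_sort σ fun i => w i - w' i,
      Finset.sum_subset (Finset.subset_univ σ) fun i _ hi => by rw [hw i hi, hw' i hi, sub_zero],
      Finset.sum_sub_distrib, h1, sub_self]
  · rw [Finset.sum_coe_sort σ fun i => (w i - w' i) • v i,
      Finset.sum_subset (Finset.subset_univ σ) fun i _ hi => by
        rw [hw i hi, hw' i hi, sub_zero, zero_smul]]
    simp only [sub_smul, Finset.sum_sub_distrib, hx, sub_self]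

/-- The complex of `faceFormula K v` is a cubical subdivision of the underlying space of `K`. -/
theorem nonempty_homeomorph_faceFormula {E : Type*} [AddCommGroup E] [Module ℝ E]
    [TopologicalSpace E] [IsTopologicalAddGroup E] [ContinuousSMul ℝ E] [T2Space E]
    (K : Geometry.SimplicialComplex ℝ E) {d : ℕ} (v : Fin d ↪ E)
    (hv : K.vertices ⊆ Set.range v) :
    Nonempty (cnfComplex (faceFormula K v) ≃ₜ K.space) := by
  classical
  have hpos : ∀ p ∈ cnfComplex (faceFormula K v), 0 < ∑ i, p i := by
    intro p hp
    obtain ⟨hp, ⟨i, hi⟩, -⟩ := mem_cnfComplex_faceFormula.1 hp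
    exact Finset.sum_pos' (fun j _ => (hp j).1) ⟨i, Finset.mem_univ _, by simp [hi]⟩
  let bary (p : Fin d → ℝ) : Fin d → ℝ := fun i => (∑ j, p j)⁻¹ * p i
  let F (p : Fin d → ℝ) : E := ∑ i, bary p i • v i
  have hbary : ∀ p ∈ cnfComplex (faceFormula K v), (∀ i, 0 ≤ bary p i) ∧
      (∀ i ∉ Finset.univ.filter fun i => p i ≠ 0, bary p i = 0) ∧ ∑ i, bary p i = 1 := by
    intro p hp
    refine ⟨fun i => mul_nonneg (inv_nonneg.2 (hpos p hp).le) (hp.1 i).1, fun i hi => ?_, ?_⟩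
    · have : p i = 0 := by simpa using hi
      simp [bary, this]
    · rw [← Finset.mul_sum, inv_mul_cancel₀ (hpos p hp).ne']
  have hF : ∀ p ∈ cnfComplex (faceFormula K v),
      F p ∈ convexHull ℝ ((Finset.univ.filter fun i => p i ≠ 0).map v : Set E) := fun p hp =>
    let ⟨h, h0, h1⟩ := hbary p hp
    mem_convexHull_map_iff.2 ⟨bary p, h, h0, h1, rfl⟩
  let G : cnfComplex (faceFormula K v) → K.space := fun p =>
    ⟨F p, K.convexHull_subset_space (mem_cnfComplex_faceFormula.1 p.2).2.2 (hF p p.2)⟩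
  have hG : Continuous G := by
    refine Continuous.subtype_mk (continuous_finsetSum _ fun i _ => ?_) _
    have hcoord (j : Fin d) : Continuous fun p : cnfComplex (faceFormula K v) => p.1 j :=
      (continuous_apply j).comp continuous_subtype_val
    exact (((continuous_finsetSum _ fun j _ => hcoord j).inv₀ fun p => (hpos p p.2).ne').mul
      (hcoord i)).smul continuous_const
  have hinj : Function.Injective G := by
    rintro ⟨p, hp⟩ ⟨q, hq⟩ hpq
    have hFpq : F p = F q := congrArg Subtype.val hpq
    have hp' := mem_cnfComplex_faceFormula.1 hp
    have hq' := mem_cnfComplex_faceFormula.1 hq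
    obtain ⟨w, -, hw0, hw1, hwx⟩ := (mem_convexHull_map_iff (x := F p)).1 <| by
      rw [Finset.map_inter, Finset.coe_inter]
      exact K.inter_subset_convexHull hp'.2.2 hq'.2.2 ⟨hF p hp, hFpq ▸ hF q hq⟩
    have hwp : w = bary p := barycentric_unique_s5 hp'.2.2
      (fun i hi => hw0 i fun h => hi (Finset.mem_inter.1 h).1) (hbary p hp).2.1
      (hw1.trans (hbary p hp).2.2.symm) hwx
    have hwq : w = bary q := barycentric_unique_s5 hq'.2.2
      (fun i hi => hw0 i fun h => hi (Finset.mem_inter.1 h).2) (hbary q hq).2.1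
      (hw1.trans (hbary q hq).2.2.symm) (hwx.trans hFpq)
    have hb : ∀ i, (∑ j, p j)⁻¹ * p i = (∑ j, q j)⁻¹ * q i := congrFun (hwp.symm.trans hwq)
    have hP := inv_pos.2 (hpos p hp)
    have hQ := inv_pos.2 (hpos q hq)
    obtain ⟨i, hi⟩ := hp'.2.1
    obtain ⟨j, hj⟩ := hq'.2.1
    have hPQ : (∑ j, p j)⁻¹ = (∑ j, q j)⁻¹ := by
      have h1 := hb i
      have h2 := hb j
      rw [hi] at h1
      rw [hj] at h2
      nlinarith [(hq'.1 i).2, (hp'.1 j).2]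
    refine Subtype.ext (funext fun k => ?_)
    have := hb k
    rw [hPQ] at this
    exact mul_left_cancel₀ hQ.ne' this
  have hsurj : Function.Surjective G := by
    rintro ⟨x, hx⟩
    obtain ⟨s, hs, hxs⟩ := Geometry.SimplicialComplex.mem_space_iff.1 hx
    obtain ⟨σ, rfl⟩ : ∃ σ : Finset (Fin d), σ.map v = s := by
      refine ⟨Finset.univ.filter fun i => v i ∈ s, ?_⟩
      ext y
      simp only [Finset.mem_map, Finset.mem_filter, Finset.mem_univ, true_and]
      refine ⟨fun ⟨i, hi, h⟩ => h ▸ hi, fun hy => ?_⟩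
      obtain ⟨i, rfl⟩ := hv (K.down_closed hs (Finset.singleton_subset_iff.2 hy)
        (Finset.singleton_nonempty y))
      exact ⟨i, hy, rfl⟩
    obtain ⟨w, hw, hw0, hw1, rfl⟩ := mem_convexHull_map_iff.1 hxs
    obtain ⟨k, hk⟩ : ∃ k, 0 < w k := by
      by_contra! h
      linarith [Finset.sum_nonpos fun i (_ : i ∈ Finset.univ) => h i]
    obtain ⟨m, -, hm⟩ := Finset.exists_max_image Finset.univ w ⟨k, Finset.mem_univ k⟩
    have hm0 : 0 < w m := hk.trans_le (hm k (Finset.mem_univ k))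
    have hmem : (fun i => w i / w m) ∈ cnfComplex (faceFormula K v) := by
      refine mem_cnfComplex_faceFormula.2 ⟨fun i => ⟨div_nonneg (hw i) hm0.le,
        (div_le_one hm0).2 (hm i (Finset.mem_univ i))⟩, ⟨m, div_self hm0.ne'⟩,
        K.down_closed hs (Finset.map_subset_map.2 fun i hi => ?_) ⟨v m, ?_⟩⟩
      · by_contra h
        simp [hw0 i h] at hi
      · exact Finset.mem_map_of_mem v (by simp [hm0.ne'])
    have hbw : bary (fun i => w i / w m) = w := by
      funext i
      simp only [bary, ← Finset.sum_div, hw1]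
      field_simp
    refine ⟨⟨_, hmem⟩, Subtype.ext ?_⟩
    change ∑ i, bary (fun i => w i / w m) i • v i = ∑ i, w i • v i
    rw [hbw]
  have hcompact : IsCompact (cnfComplex (faceFormula K v)) := by
    have hclosed : IsClosed {p : Fin d → ℝ | ∀ C ∈ faceFormula K v, ClauseHolds C p} := by
      simp only [Set.ofPred_forall, ClauseHolds]
      refine isClosed_biInter fun C _ => ?_
      have : {p : Fin d → ℝ | ∃ l ∈ C, p l.1 = l.2.toNat} =
          ⋃ l ∈ C, {p : Fin d → ℝ | p l.1 = l.2.toNat} := by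
        ext
        simp
      rw [this]
      exact isClosed_biUnion_finset fun l _ => isClosed_eq (by fun_prop) continuous_const
    convert (isCompact_univ_pi fun _ : Fin d => isCompact_Icc (a := (0 : ℝ)) (b := 1)).inter_right
      hclosed using 1
    ext
    simp only [cnfComplex, Set.mem_ofPred_eq, Set.mem_inter_iff, Set.mem_univ_pi]
  have := isCompact_iff_compactSpace.1 hcompact
  exact ⟨hG.homeoOfEquivCompactToT2 (f := Equiv.ofBijective G ⟨hinj, hsurj⟩)⟩

/-- 3-SAT is homotopy-universal for finite simplicial complexes. -/
theorem threeSat_homotopy_universal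
    (n : ℕ) (K : Geometry.SimplicialComplex ℝ (Fin n → ℝ)) (hK : K.faces.Finite) :
    ∃ (d : ℕ) (Φ : Finset (Finset (Fin d × Bool))),
      (∀ C ∈ Φ, C.card ≤ 3) ∧
      Nonempty (ContinuousMap.HomotopyEquiv
        (inducedCubicalComplex (cnfDisc Φ)) K.space) := by
  have hfin : K.vertices.Finite := by
    rw [Geometry.SimplicialComplex.vertices_eq]
    exact hK.biUnion fun s _ => s.finite_toSet
  have := hfin.to_subtype
  obtain ⟨m, ⟨e⟩⟩ := Finite.exists_equiv_fin K.vertices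
  let v : Fin m ↪ (Fin n → ℝ) := e.symm.toEmbedding.trans (Function.Embedding.subtype _)
  obtain ⟨f⟩ := nonempty_homeomorph_faceFormula K v fun x hx => ⟨e ⟨x, hx⟩, by simp [v]⟩
  obtain ⟨d, Φ, hΦ, hcard, ⟨g⟩⟩ :=
    exists_threeSat_homotopyEquiv _ (nonTautological_faceFormula K v)
  refine ⟨d, Φ, hcard, ?_⟩
  rw [inducedCubicalComplex_cnfDisc hΦ]
  exact ⟨g.trans f.toHomotopyEquiv⟩
end

section
/- Let Φ be a CNF formula over Fin d each of whose clauses contains at most one positive literal, i.e. at most one literal of the form (i, true) (a Horn SAT formula). Then for every natural number p ≥ 1, the induced cubical complex N(disc(Φ)) is not homotopy equivalent to the p-dimensional unit sphere Metric.sphere (0 : EuclideanSpace ℝ (Fin (p+1))) 1. -/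
section SphereNotContractible

open Module Metric MeasureTheory

theorem LinearMap.det_eq_sum_det_one_add_smul {E : Type*} [AddCommGroup E] [Module ℝ E]
    [FiniteDimensional ℝ E] (A : E →ₗ[ℝ] E) (s : Finset ℝ) (hs : s.card = finrank ℝ E + 1) :
    LinearMap.det A =
      ∑ t ∈ s, LinearMap.det (1 + t • A) / ∏ u ∈ s.erase t, (t - u) := by
  classical
  let b := finBasis ℝ E
  let M := LinearMap.toMatrix b b A
  let P : Polynomial ℝ := Matrix.det
    ((Polynomial.X : Polynomial ℝ) • M.map Polynomial.C + (1 : Matrix _ _ ℝ).map Polynomial.C)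
  have hdeg : P.degree < s.card := by
    refine (Polynomial.degree_le_natDegree).trans_lt ?_
    have := Polynomial.natDegree_det_X_add_C_le M 1
    rw [Fintype.card_fin] at this
    rw [hs]
    exact_mod_cast Nat.lt_succ_of_le this
  have hcoeff : P.coeff (s.card - 1) = LinearMap.det A := by
    have := Polynomial.coeff_det_X_add_C_card M 1
    rw [Fintype.card_fin] at this
    rw [hs, Nat.add_sub_cancel]
    exact this.trans (LinearMap.det_toMatrix b A)
  have heval (t : ℝ) : P.eval t = LinearMap.det (1 + t • A) := by
    rw [← LinearMap.det_toMatrix b, map_add, map_smul, LinearMap.toMatrix_one, add_comm]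
    simp only [P, ← Polynomial.coe_evalRingHom, RingHom.map_det]
    congr 1
    ext i j
    have hM : LinearMap.toMatrix b b A = M := rfl
    rcases eq_or_ne i j with rfl | hij
    · simp [hM, mul_comm t]
    · simp [hM, hij, mul_comm t]
  rw [← hcoeff, Lagrange.coeff_eq_sum (v := fun t : ℝ ↦ t) (Set.injOn_id _) hdeg]
  simp only [heval]

theorem ContinuousLinearMap.det_one_add_pos {E : Type*} [NormedAddCommGroup E] [NormedSpace ℝ E]
    [FiniteDimensional ℝ E] {B : E →L[ℝ] E} (hB : ‖B‖ < 1) : 0 < (1 + B).det := by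
  have : CompleteSpace E := FiniteDimensional.complete ℝ E
  have hcont : ContinuousOn (fun s : ℝ ↦ (1 + s • B).det) (Set.Icc 0 1) :=
    (ContinuousLinearMap.continuous_det.comp (by fun_prop)).continuousOn
  have hne (s : ℝ) (hs : s ∈ Set.Icc (0 : ℝ) 1) : (1 + s • B).det ≠ 0 := by
    have hn : ‖-(s • B)‖ < 1 := by
      rw [norm_neg, norm_smul, Real.norm_of_nonneg hs.1]
      exact (mul_le_of_le_one_left (norm_nonneg _) hs.2).trans_lt hB
    have hu := isUnit_one_sub_of_norm_lt_one hn
    rw [sub_neg_eq_add] at hu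
    exact ((hu.map (ContinuousLinearMap.toLinearMapRingHom : (E →L[ℝ] E) →+* E →ₗ[ℝ] E)).map
      LinearMap.det).ne_zero
  by_contra! hle
  obtain ⟨s, hs, h0⟩ := intermediate_value_Icc' zero_le_one hcont
    (show (0 : ℝ) ∈ Set.Icc _ _ from ⟨by simpa using hle, by simp [ContinuousLinearMap.det]⟩)
  exact hne s hs h0

theorem det_fderiv_eq_zero_of_norm_eq_one {E : Type*} [NormedAddCommGroup E]
    [InnerProductSpace ℝ E] [FiniteDimensional ℝ E] {f : E → E} {x : E}
    (hf : DifferentiableAt ℝ f x) (h : ∀ᶠ y in nhds x, ‖f y‖ = 1) : (fderiv ℝ f x).det = 0 := by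
  by_contra hdet
  have hd := hf.hasFDerivAt.norm_sq
  have hc : HasFDerivAt (fun y ↦ ‖f y‖ ^ 2) (0 : E →L[ℝ] ℝ) x :=
    (hasFDerivAt_const (1 : ℝ) x).congr_of_eventuallyEq (h.mono fun y hy ↦ by simp [hy])
  obtain ⟨v, hv⟩ : f x ∈ LinearMap.range (fderiv ℝ f x : E →ₗ[ℝ] E) := by
    rw [(LinearMap.isUnit_iff_range_eq_top _).1
      ((LinearMap.isUnit_iff_isUnit_det _).2 (isUnit_iff_ne_zero.2 hdet))]
    trivial
  have := congrArg (fun L : E →L[ℝ] ℝ ↦ L v) (hd.unique hc)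
  have hv' : fderiv ℝ f x v = f x := hv
  simp [hv', h.self_of_nhds] at this

theorem not_exists_contDiff_sphere_retraction {E : Type*} [NormedAddCommGroup E]
    [InnerProductSpace ℝ E] [FiniteDimensional ℝ E] [Nontrivial E] {r : E → E}
    (hr : ContDiff ℝ 1 r) (hnorm : ∀ x, ‖r x‖ = 1)
    (hrad : ∀ x, 1 ≤ ‖x‖ → r x = ‖x‖⁻¹ • x) : False := by
  borelize E
  let μ : Measure E := Measure.addHaar
  let χ : ContDiffBump (0 : E) := ⟨2, 3, by norm_num, by norm_num⟩
  let ψ : E → E := fun x ↦ χ x • r x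
  have hψ : ContDiff ℝ 1 ψ := χ.contDiff.smul hr
  have hψ_eq {x : E} (hx : ‖x‖ ≤ 2) : ψ x = r x := by
    simp [ψ, χ.one_of_mem_closedBall (x := x) (by simpa [χ] using hx)]
  have hψ_norm (x : E) : ‖ψ x‖ ≤ 1 := by
    simpa [ψ, norm_smul, hnorm, abs_of_nonneg χ.nonneg] using χ.le_one
  obtain ⟨K, hK⟩ := ContDiff.lipschitzWith_of_hasCompactSupport (𝕂 := ℝ)
    (f := ψ) (χ.hasCompactSupport.smul_right) hψ one_ne_zero
  let Df : E → E →L[ℝ] E := fderiv ℝ ψ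
  have hDf : Continuous Df := hψ.continuous_fderiv one_ne_zero
  have hDf_norm (x : E) : ‖Df x‖ ≤ K := norm_fderiv_le_of_lipschitz ℝ hK
  have hdet0 (x : E) (hx : x ∈ ball (0 : E) 1) : (Df x).det = 0 := by
    refine det_fderiv_eq_zero_of_norm_eq_one (hψ.differentiable one_ne_zero x) ?_
    filter_upwards [isOpen_ball.mem_nhds hx] with y hy
    rw [hψ_eq (by rw [mem_ball_zero_iff] at hy; linarith), hnorm]
  have hvol {t : ℝ} (ht : 0 < t) (ht1 : t < 1) (htK : t * K < 1) :
      ∫ x in ball (0 : E) 1, (1 + t • Df x).det ∂μ =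
        (1 + t) ^ finrank ℝ E * μ.real (ball 0 1) := by
    let g : E → E := fun x ↦ x + t • ψ x
    have hg (x : E) : HasFDerivAt g (1 + t • Df x) x :=
      (hasFDerivAt_id x).add (((hψ.differentiable one_ne_zero) x).hasFDerivAt.const_smul t)
    have happrox : ApproximatesLinearOn g
        ((ContinuousLinearEquiv.refl ℝ E : E ≃L[ℝ] E) : E →L[ℝ] E) Set.univ
        (t.toNNReal * K) := by
      intro x _ y _
      have h1 : g x - g y - (x - y) = t • (ψ x - ψ y) := by simp only [g, smul_sub]; abel
      simp only [ContinuousLinearEquiv.coe_coe, ContinuousLinearEquiv.refl_apply]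
      rw [h1, norm_smul, Real.norm_of_nonneg ht.le]
      rw [NNReal.coe_mul, Real.coe_toNNReal t ht.le, mul_assoc]
      exact mul_le_mul_of_nonneg_left (hK.norm_sub_le x y) ht.le
    have hc : Subsingleton E ∨ (t.toNNReal * K : NNReal) <
        ‖((ContinuousLinearEquiv.refl ℝ E).symm : E →L[ℝ] E)‖₊⁻¹ := by
      right
      have : ‖((ContinuousLinearEquiv.refl ℝ E).symm : E →L[ℝ] E)‖₊ = 1 := by
        ext
        exact ContinuousLinearMap.norm_id
      rw [this, inv_one, ← NNReal.coe_lt_coe, NNReal.coe_mul, Real.coe_toNNReal t ht.le]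
      exact htK
    have hinj : Set.InjOn g (ball 0 1) := (happrox.injOn hc).mono (Set.subset_univ _)
    have himage : g '' ball 0 1 = ball 0 (1 + t) := by
      ext y
      rw [mem_ball_zero_iff]
      constructor
      · rintro ⟨x, hx, rfl⟩
        rw [mem_ball_zero_iff] at hx
        calc ‖g x‖ ≤ ‖x‖ + t * ‖ψ x‖ := (norm_add_le _ _).trans_eq (by
              rw [norm_smul, Real.norm_of_nonneg ht.le])
          _ < 1 + t := by nlinarith [hψ_norm x]
      · intro hy
        obtain ⟨x, rfl⟩ := happrox.surjective hc y
        refine ⟨x, ?_, rfl⟩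
        rw [mem_ball_zero_iff]
        by_contra! hx
        have hgx : ‖g x‖ = ‖x‖ + t * χ x := by
          have hx0 : 0 < ‖x‖ := by linarith
          have h1 : g x = (1 + t * χ x * ‖x‖⁻¹) • x := by
            simp only [g, ψ, hrad x hx, add_smul, one_smul, smul_smul, mul_assoc]
          have h2 : 0 ≤ χ x := χ.nonneg
          rw [h1, norm_smul, Real.norm_of_nonneg (by positivity)]
          field_simp
        rcases le_total ‖x‖ 2 with h2 | h2
        · rw [hgx, χ.one_of_mem_closedBall (x := x) (by simpa [χ] using h2)] at hy
          linarith
        · have := mul_nonneg ht.le (χ.nonneg (x := x))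
          linarith
    have hcv := integral_image_eq_integral_abs_det_fderiv_smul μ measurableSet_ball
      (fun x _ ↦ (hg x).hasFDerivWithinAt) hinj (fun _ ↦ (1 : ℝ))
    rw [himage, integral_const, measureReal_restrict_apply_univ, smul_eq_mul, mul_one,
      measureReal_def, Measure.addHaar_ball μ 0 (by linarith : 0 ≤ 1 + t), ENNReal.toReal_mul,
      ENNReal.toReal_ofReal (by positivity), ← measureReal_def] at hcv
    rw [hcv]
    refine integral_congr_ae (Filter.Eventually.of_forall fun x ↦ ?_)
    have : 0 < (1 + t • Df x).det := by
      refine ContinuousLinearMap.det_one_add_pos ?_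
      rw [norm_smul, Real.norm_of_nonneg ht.le]
      exact (mul_le_mul_of_nonneg_left (hDf_norm x) ht.le).trans_lt htK
    simp [abs_of_pos this]
  obtain ⟨s, hs_sub, hs_card⟩ := (Set.Ioo_infinite
    (show (0 : ℝ) < min 1 (1 / ((K : ℝ) + 1)) by positivity)).exists_subset_card_eq (finrank ℝ E + 1)
  have hs (t : ℝ) (ht : t ∈ s) : 0 < t ∧ t < 1 ∧ t * K < 1 := by
    obtain ⟨h0, h1⟩ := hs_sub ht
    rw [lt_min_iff, lt_div_iff₀ (by positivity)] at h1
    exact ⟨h0, h1.1, by nlinarith [h1.2]⟩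
  have h_integrable (t : ℝ) : IntegrableOn (fun x ↦ (1 + t • Df x).det) (ball (0 : E) 1) μ := by
    have : Continuous fun x ↦ (1 + t • Df x).det :=
      ContinuousLinearMap.continuous_det.comp (by fun_prop)
    exact (this.continuousOn.integrableOn_compact (isCompact_closedBall 0 1)).mono_set
      ball_subset_closedBall
  have hzero : ∫ x in ball (0 : E) 1, (Df x).det ∂μ = 0 := by
    rw [setIntegral_congr_fun measurableSet_ball hdet0]
    simp
  have hsum : ∫ x in ball (0 : E) 1, (Df x).det ∂μ = μ.real (ball 0 1) := by
    calc ∫ x in ball (0 : E) 1, (Df x).det ∂μ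
        = ∫ x in ball (0 : E) 1,
            ∑ t ∈ s, (1 + t • Df x).det / ∏ u ∈ s.erase t, (t - u) ∂μ :=
          integral_congr_ae (Filter.Eventually.of_forall fun x ↦
            LinearMap.det_eq_sum_det_one_add_smul (Df x : E →ₗ[ℝ] E) s hs_card)
      _ = ∑ t ∈ s, (1 + t) ^ finrank ℝ E * μ.real (ball 0 1) / ∏ u ∈ s.erase t, (t - u) := by
          rw [integral_finsetSum _ fun t _ ↦ (h_integrable t).div_const _]
          refine Finset.sum_congr rfl fun t ht ↦ ?_
          obtain ⟨h0, h1, h2⟩ := hs t ht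
          rw [integral_div, hvol h0 h1 h2]
      _ = μ.real (ball 0 1) := by
          have h1 := LinearMap.det_eq_sum_det_one_add_smul (1 : E →ₗ[ℝ] E) s hs_card
          have h2 (t : ℝ) : LinearMap.det (1 + t • (1 : E →ₗ[ℝ] E)) = (1 + t) ^ finrank ℝ E := by
            have h := LinearMap.det_smul (1 + t) (1 : E →ₗ[ℝ] E)
            rwa [map_one, mul_one, add_smul, one_smul] at h
          simp only [h2, map_one] at h1
          calc _ = (∑ t ∈ s, (1 + t) ^ finrank ℝ E / ∏ u ∈ s.erase t, (t - u)) *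
                μ.real (ball (0 : E) 1) := by
                rw [Finset.sum_mul]
                exact Finset.sum_congr rfl fun t _ ↦ by ring
            _ = _ := by rw [← h1, one_mul]
  have hpos : 0 < μ.real (ball (0 : E) 1) :=
    ENNReal.toReal_pos (measure_ball_pos μ 0 one_pos).ne' measure_ball_lt_top.ne
  linarith

theorem not_exists_continuous_sphere_retraction {E : Type*} [NormedAddCommGroup E]
    [InnerProductSpace ℝ E] [FiniteDimensional ℝ E] [Nontrivial E] {r : E → E}
    (hr : Continuous r) (hnorm : ∀ x, ‖r x‖ = 1)
    (hrad : ∀ x, 1 / 2 ≤ ‖x‖ → r x = ‖x‖⁻¹ • x) : False := by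
  let χ : ContDiffBump (0 : E) := ⟨1, 2, by norm_num, by norm_num⟩
  let η : ContDiffBump (0 : E) := ⟨1 / 2, 1, by norm_num, by norm_num⟩
  have hη_one {x : E} (hx : ‖x‖ ≤ 1 / 2) : η x = 1 :=
    η.one_of_mem_closedBall (by simpa [η] using hx)
  have hη_zero {x : E} (hx : 1 ≤ ‖x‖) : η x = 0 :=
    η.zero_of_le_dist (by simpa [η] using hx)
  obtain ⟨g, hg, hgr⟩ := UniformContinuous.exists_contDiff_dist_le (f := fun x ↦ χ x • r x)
    ((χ.continuous.smul hr).uniformContinuous_of_tendsto_cocompact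
      (χ.hasCompactSupport.smul_right.is_zero_at_infty)) (ε := 1 / 2) (by norm_num)
  let h : E → E := fun x ↦ η x • g x + (1 - η x) • ‖x‖⁻¹ • x
  have hsmooth : ContDiff ℝ 1 h := by
    refine (η.contDiff.smul (hg.of_le (by exact_mod_cast le_top))).add
      (contDiff_iff_contDiffAt.2 fun x ↦ ?_)
    by_cases hx : x = 0
    · refine contDiffAt_const (c := (0 : E)) |>.congr_of_eventuallyEq ?_
      filter_upwards [closedBall_mem_nhds x (show (0 : ℝ) < 1 / 2 by norm_num)] with y hy
      rw [hx, mem_closedBall_zero_iff] at hy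
      simp [hη_one hy]
    · exact (contDiffAt_const.sub η.contDiff.contDiffAt).smul
        (((contDiffAt_norm ℝ hx).inv (norm_ne_zero_iff.2 hx)).smul contDiffAt_id)
  have hclose (x : E) : ‖h x - r x‖ < 1 := by
    have h1 : h x - r x = η x • (g x - r x) := by
      have : (1 - η x) • ‖x‖⁻¹ • x = (1 - η x) • r x := by
        rcases le_total ‖x‖ (1 / 2) with hx | hx
        · simp [hη_one hx]
        · rw [hrad x hx]
      simp only [h]
      rw [this, smul_sub, sub_smul, one_smul]
      abel
    rw [h1, norm_smul, Real.norm_of_nonneg η.nonneg]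
    rcases le_total 1 ‖x‖ with hx | hx
    · simp [hη_zero hx]
    · have h2 := hgr x
      rw [χ.one_of_mem_closedBall (x := x) (by simpa [χ] using hx), one_smul, dist_eq_norm] at h2
      nlinarith [η.nonneg (x := x), η.le_one (x := x), norm_nonneg (g x - r x)]
  have hne (x : E) : h x ≠ 0 := by
    intro h0
    have := hclose x
    rw [h0, zero_sub, norm_neg, hnorm] at this
    exact lt_irrefl _ this
  refine not_exists_contDiff_sphere_retraction (r := fun x ↦ ‖h x‖⁻¹ • h x)
    (((hsmooth.norm ℝ hne).inv fun x ↦ norm_ne_zero_iff.2 (hne x)).smul hsmooth)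
    (fun x ↦ norm_smul_inv_norm (𝕜 := ℝ) (hne x)) fun x hx ↦ ?_
  have hx0 : x ≠ 0 := by
    rintro rfl
    norm_num at hx
  have h1 : h x = ‖x‖⁻¹ • x := by simp [h, hη_zero hx]
  have h2 : ‖‖x‖⁻¹ • x‖ = 1 := norm_smul_inv_norm (𝕜 := ℝ) hx0
  simp only [h1, h2, inv_one, one_smul]

theorem not_contractibleSpace_sphere {E : Type*} [NormedAddCommGroup E]
    [InnerProductSpace ℝ E] [FiniteDimensional ℝ E] [Nontrivial E] :
    ¬ ContractibleSpace (sphere (0 : E) 1) := by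
  intro hS
  obtain ⟨y, ⟨H⟩⟩ := id_nullhomotopic (sphere (0 : E) 1)
  classical
  let u : E → sphere (0 : E) 1 := fun x ↦
    if hx : x = 0 then y else
      ⟨‖x‖⁻¹ • x, mem_sphere_zero_iff_norm.2 (norm_smul_inv_norm (𝕜 := ℝ) hx)⟩
  have hu {x : E} (hx : x ≠ 0) : (u x : E) = ‖x‖⁻¹ • x := by simp [u, hx]
  let τ : E → unitInterval := fun x ↦ Set.projIcc 0 1 zero_le_one (2 - 4 * ‖x‖)
  have hτ : Continuous τ := continuous_projIcc.comp (by fun_prop)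
  have hucont (x : E) (hx : x ≠ 0) : ContinuousAt u x := by
    rw [Topology.IsInducing.subtypeVal.continuousAt_iff]
    refine ContinuousAt.congr (f := fun x : E ↦ ‖x‖⁻¹ • x) ?_ ?_
    · exact (continuousAt_id.norm.inv₀ (norm_ne_zero_iff.2 hx)).smul continuousAt_id
    · filter_upwards [isOpen_ne.mem_nhds hx] with z hz using (hu hz).symm
  refine not_exists_continuous_sphere_retraction (E := E) (r := fun x ↦ (H (τ x, u x) : E))
    (continuous_subtype_val.comp (continuous_iff_continuousAt.2 fun x ↦ ?_))
    (fun x ↦ mem_sphere_zero_iff_norm.1 (H (τ x, u x)).2) fun x hx ↦ ?_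
  · by_cases hx : x = 0
    · refine (continuousAt_const (y := y)).congr ?_
      filter_upwards [closedBall_mem_nhds x (show (0 : ℝ) < 1 / 4 by norm_num)] with z hz
      rw [hx, mem_closedBall_zero_iff] at hz
      have : τ z = 1 := Set.projIcc_of_right_le _ (by linarith)
      simp [this]
    · exact H.continuous.continuousAt.comp (hτ.continuousAt.prodMk (hucont x hx))
  · have h0 : τ x = 0 := Set.projIcc_of_le_left _ (by linarith)
    have hx0 : x ≠ 0 := by
      rintro rfl
      norm_num at hx
    simp [h0, hu hx0]

end SphereNotContractible

theorem ContinuousMap.HomotopyEquiv.pathConnectedSpace {X Y : Type*} [TopologicalSpace X]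
    [TopologicalSpace Y] [PathConnectedSpace Y] (e : ContinuousMap.HomotopyEquiv X Y) :
    PathConnectedSpace X := by
  obtain ⟨H⟩ := e.left_inv
  have hj (x : X) : Joined (e.invFun (e.toFun x)) x := ⟨H.evalAt x⟩
  refine ⟨(PathConnectedSpace.nonempty (X := Y)).map e.invFun, fun x y ↦ ?_⟩
  exact (hj x).symm.trans
    (((PathConnectedSpace.joined (e.toFun x) (e.toFun y)).map e.invFun.continuous).trans (hj y))

theorem inf_mem_cnfDisc_of_horn {V : Type*} {Φ : Finset (Finset (V × Bool))}
    (hHorn : ∀ C ∈ Φ, (C.filter fun l => l.2 = true).card ≤ 1) {x y : V → Bool}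
    (hx : x ∈ cnfDisc Φ) (hy : y ∈ cnfDisc Φ) : x ⊓ y ∈ cnfDisc Φ := by
  intro C hC
  obtain ⟨⟨i, a⟩, hi, hxi⟩ := hx C hC
  obtain ⟨⟨j, b⟩, hj, hyj⟩ := hy C hC
  cases a
  · exact ⟨_, hi, by simp_all⟩
  cases b
  · exact ⟨_, hj, by simp_all⟩
  have hij := Finset.card_le_one.1 (hHorn C hC) (i, true) (by simp [hi]) (j, true) (by simp [hj])
  obtain rfl : i = j := congrArg Prod.fst hij
  exact ⟨_, hi, by simp_all⟩

/-- The vertex of the real unit cube given by a Boolean vector. -/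
def boolVertex {V : Type*} (t : V → Bool) : V → ℝ := fun i ↦ if t i then 1 else 0

/-- `t` is a vertex of the smallest face of the unit cube containing `p`. -/
def IsFaceVertex {V : Type*} (t : V → Bool) (p : V → ℝ) : Prop :=
  ∀ i, (p i = 0 → t i = false) ∧ (p i = 1 → t i = true)

/-- The coordinates along which `t` can be decreased inside `X`. -/
def downSet {V : Type*} [DecidableEq V] (X : Set (V → Bool)) (t : V → Bool) : Set V :=
  {i | t i = true ∧ Function.update t i false ∈ X}

section Collapse

variable {V : Type*} {X : Set (V → Bool)} {t : V → Bool} {p : V → ℝ}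

theorem mem_inducedCubicalComplex_diff_singleton :
    p ∈ inducedCubicalComplex (X \ {t}) ↔
      p ∈ inducedCubicalComplex X ∧ ¬ IsFaceVertex t p := by
  constructor
  · rintro ⟨h1, h2⟩
    exact ⟨⟨h1, fun v hv ↦ (h2 v hv).1⟩, fun h ↦ (h2 t h).2 rfl⟩
  · rintro ⟨⟨h1, h2⟩, h3⟩
    refine ⟨h1, fun v hv ↦ ⟨h2 v hv, ?_⟩⟩
    rintro rfl
    exact h3 hv

theorem boolVertex_mem (ht : t ∈ X) : boolVertex t ∈ inducedCubicalComplex X := by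
  refine ⟨fun i ↦ by unfold boolVertex; split_ifs <;> norm_num, fun v hv ↦ ?_⟩
  convert ht
  ext i
  have := hv i
  unfold boolVertex at this
  cases h : t i <;> simp_all

section

variable [Fintype V]

theorem dist_boolVertex_le_one (hp : p ∈ inducedCubicalComplex X) :
    dist p (boolVertex t) ≤ 1 := by
  refine (dist_pi_le_iff zero_le_one).2 fun i ↦ ?_
  obtain ⟨h0, h1⟩ := hp.1 i
  rw [Real.dist_eq, abs_le, boolVertex]
  split_ifs <;> constructor <;> linarith

theorem isFaceVertex_iff_dist_lt_one (hp : p ∈ inducedCubicalComplex X) :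
    IsFaceVertex t p ↔ dist p (boolVertex t) < 1 := by
  rw [dist_pi_lt_iff zero_lt_one]
  refine forall_congr' fun i ↦ ?_
  obtain ⟨h0, h1⟩ := hp.1 i
  rw [Real.dist_eq, abs_lt, boolVertex]
  cases ht : t i
  · have : p i < 1 ↔ p i ≠ 1 := h1.lt_iff_ne
    simp only [Bool.false_eq_true, if_false, sub_zero, this]
    grind
  · have : 0 < p i ↔ p i ≠ 0 := by rw [h0.lt_iff_ne, ne_comm]
    simp only [if_true]
    grind

theorem dist_boolVertex_eq_one (hp : p ∈ inducedCubicalComplex X) (h : ¬ IsFaceVertex t p) :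
    dist p (boolVertex t) = 1 :=
  le_antisymm (dist_boolVertex_le_one hp)
    (not_lt.1 fun h' ↦ h ((isFaceVertex_iff_dist_lt_one hp).2 h'))

end

variable [DecidableEq V]

theorem eq_boolVertex_of_notMem_downSet (ht : Maximal (· ∈ X) t)
    (hp : p ∈ inducedCubicalComplex X) (h : IsFaceVertex t p) {i : V} (hi : i ∉ downSet X t) :
    p i = boolVertex t i := by
  by_contra hne
  have hp0 : p i ≠ 0 := fun h0 ↦ hne (by simp [boolVertex, h0, (h i).1 h0])
  have hp1 : p i ≠ 1 := fun h1 ↦ hne (by simp [boolVertex, h1, (h i).2 h1])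
  have hmem (b : Bool) : Function.update t i b ∈ X := by
    refine hp.2 _ fun j ↦ ?_
    rcases eq_or_ne j i with rfl | hj
    · simp [hp0, hp1]
    · simpa [hj] using h j
  have hti : t i = true := by
    have hle := ht.2 (hmem true) (le_update_iff.2 ⟨Bool.le_true _, fun _ _ ↦ le_rfl⟩) i
    rw [Function.update_self] at hle
    exact Bool.eq_true_of_true_le hle
  exact hi ⟨hti, hmem false⟩

theorem ite_mem_of_subset_downSet (hX : ∀ x ∈ X, ∀ y ∈ X, x ⊓ y ∈ X) (ht : t ∈ X) (F : Finset V)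
    (hF : ∀ i ∈ F, i ∈ downSet X t) : (fun i ↦ if i ∈ F then false else t i) ∈ X := by
  induction F using Finset.induction_on with
  | empty => simpa using ht
  | insert i F _ ih =>
    convert hX _ (hF i (Finset.mem_insert_self i F)).2 _
      (ih fun j hj ↦ hF j (Finset.mem_insert_of_mem hj)) using 1
    ext j
    rcases eq_or_ne j i with rfl | hj
    · simp
    · by_cases hjF : j ∈ F <;> simp [hj, hjF]

variable [Fintype V]

theorem mem_of_eqOn_compl_downSet (hX : ∀ x ∈ X, ∀ y ∈ X, x ⊓ y ∈ X) (ht : t ∈ X) {v : V → Bool}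
    (hv : ∀ i ∉ downSet X t, v i = t i) : v ∈ X := by
  classical
  convert ite_mem_of_subset_downSet hX ht
    (Finset.univ.filter fun i ↦ i ∈ downSet X t ∧ v i = false) (by simp +contextual) using 1
  ext i
  by_cases hi : i ∈ downSet X t
  · have := hi.1
    cases h : v i <;> simp [hi, h, this]
  · simp [hi, hv i hi]

open scoped Classical in
/-- The straight-line collapse of the cube spanned by `t` and `downSet X t` away from `t`. -/
noncomputable def collapse (X : Set (V → Bool)) (t : V → Bool) (s : ℝ) (p : V → ℝ) : V → ℝ :=
  fun i ↦ p i - if i ∈ downSet X t then s * (1 - dist p (boolVertex t)) else 0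

theorem continuous_collapse : Continuous fun q : ℝ × (V → ℝ) ↦ collapse X t q.1 q.2 := by
  refine continuous_pi fun i ↦ ?_
  unfold collapse
  split_ifs <;> fun_prop

theorem collapse_zero : collapse X t 0 p = p := by
  ext i
  simp [collapse]

theorem collapse_eq_self (hp : p ∈ inducedCubicalComplex X) (h : ¬ IsFaceVertex t p) (s : ℝ) :
    collapse X t s p = p := by
  ext i
  simp [collapse, dist_boolVertex_eq_one hp h]

theorem one_sub_dist_le (i : V) (hi : i ∈ downSet X t) : 1 - dist p (boolVertex t) ≤ p i := by
  have h := dist_le_pi_dist p (boolVertex t) i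
  rw [Real.dist_eq, boolVertex, if_pos hi.1] at h
  have := neg_abs_le (p i - 1)
  linarith

theorem collapse_mem (hX : ∀ x ∈ X, ∀ y ∈ X, x ⊓ y ∈ X) (ht : Maximal (· ∈ X) t)
    (hp : p ∈ inducedCubicalComplex X) {s : ℝ} (hs0 : 0 ≤ s) (hs1 : s ≤ 1) :
    collapse X t s p ∈ inducedCubicalComplex X := by
  by_cases h : IsFaceVertex t p
  · have hd := dist_boolVertex_le_one (t := t) hp
    have hoff {i : V} (hi : i ∉ downSet X t) : collapse X t s p i = boolVertex t i := by
      simp [collapse, hi, eq_boolVertex_of_notMem_downSet ht hp h hi]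
    refine ⟨fun i ↦ ?_, fun v hv ↦ mem_of_eqOn_compl_downSet hX ht.1 fun i hi ↦ ?_⟩
    · by_cases hi : i ∈ downSet X t
      · have h1 := one_sub_dist_le (p := p) i hi
        obtain ⟨h2, h3⟩ := hp.1 i
        simp only [collapse, if_pos hi]
        constructor <;> nlinarith
      · rw [hoff hi]
        exact (boolVertex_mem ht.1).1 i
    · have := hv i
      rw [hoff hi, boolVertex] at this
      cases h : t i <;> simp_all
  · rwa [collapse_eq_self hp h]

theorem collapse_one_mem (hX : ∀ x ∈ X, ∀ y ∈ X, x ⊓ y ∈ X) (ht : Maximal (· ∈ X) t)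
    (hne : (downSet X t).Nonempty) (hp : p ∈ inducedCubicalComplex X) :
    collapse X t 1 p ∈ inducedCubicalComplex (X \ {t}) := by
  refine mem_inducedCubicalComplex_diff_singleton.2
    ⟨collapse_mem hX ht hp zero_le_one le_rfl, fun hq ↦ ?_⟩
  by_cases h : IsFaceVertex t p
  · obtain ⟨i, hi, hmin⟩ := (downSet X t).toFinite.exists_minimalFor p _ hne
    have hle : dist p (boolVertex t) ≤ 1 - p i := by
      refine (dist_pi_le_iff (by linarith [(hp.1 i).2])).2 fun j ↦ ?_
      by_cases hj : j ∈ downSet X t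
      · have h1 : p i ≤ p j := by
          rcases le_total (p i) (p j) with h | h
          · exact h
          · exact hmin hj h
        rw [Real.dist_eq, boolVertex, if_pos hj.1, abs_sub_comm,
          abs_of_nonneg (by linarith [(hp.1 j).2])]
        linarith
      · rw [eq_boolVertex_of_notMem_downSet ht hp h hj, dist_self]
        linarith [(hp.1 i).2]
    have h0 : collapse X t 1 p i = 0 := by
      have := one_sub_dist_le (p := p) i hi
      simp only [collapse, if_pos hi]
      linarith
    simpa [hi.1] using (hq i).1 h0
  · rw [collapse_eq_self hp h] at hq
    exact h hq

/-- Removing a maximal non-isolated vertex of a meet-closed set does not change the homotopy type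
of the induced cubical complex. -/
noncomputable def collapseHomotopyEquiv (hX : ∀ x ∈ X, ∀ y ∈ X, x ⊓ y ∈ X)
    (ht : Maximal (· ∈ X) t) (hne : (downSet X t).Nonempty) :
    ContinuousMap.HomotopyEquiv (inducedCubicalComplex X) (inducedCubicalComplex (X \ {t})) where
  toFun :=
    { toFun := fun p ↦ ⟨collapse X t 1 p, collapse_one_mem hX ht hne p.2⟩
      continuous_toFun := (continuous_collapse.comp
        (continuous_const.prodMk continuous_subtype_val)).subtype_mk _ }
  invFun :=
    { toFun := fun p ↦ ⟨p, (mem_inducedCubicalComplex_diff_singleton.1 p.2).1⟩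
      continuous_toFun := continuous_subtype_val.subtype_mk _ }
  left_inv := ContinuousMap.Homotopic.symm
    ⟨{  toFun := fun q ↦ ⟨collapse X t q.1 q.2, collapse_mem hX ht q.2.2 q.1.2.1 q.1.2.2⟩
        continuous_toFun := (continuous_collapse.comp ((continuous_subtype_val.comp
          continuous_fst).prodMk (continuous_subtype_val.comp continuous_snd))).subtype_mk _
        map_zero_left := fun p ↦ Subtype.ext collapse_zero
        map_one_left := fun p ↦ rfl }⟩
  right_inv := by
    convert ContinuousMap.Homotopic.refl _ using 1
    ext1 p
    obtain ⟨h1, h2⟩ := mem_inducedCubicalComplex_diff_singleton.1 p.2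
    exact Subtype.ext (collapse_eq_self h1 h2 1).symm

theorem subsingleton_of_downSet_eq_empty (ht : Maximal (· ∈ X) t) (he : downSet X t = ∅)
    [PreconnectedSpace (inducedCubicalComplex X)] : Subsingleton (inducedCubicalComplex X) := by
  have heq {p : V → ℝ} (hp : p ∈ inducedCubicalComplex X) (h : IsFaceVertex t p) :
      p = boolVertex t :=
    funext fun i ↦ eq_boolVertex_of_notMem_downSet ht hp h (by simp [he])
  suffices hall : ∀ p : inducedCubicalComplex X, IsFaceVertex t p from
    ⟨fun p q ↦ Subtype.ext ((heq p.2 (hall p)).trans (heq q.2 (hall q)).symm)⟩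
  by_contra! ⟨q, hq⟩
  have hcont : Continuous fun p : inducedCubicalComplex X ↦ dist (p : V → ℝ) (boolVertex t) := by
    fun_prop
  obtain ⟨p, hp⟩ := intermediate_value_univ ⟨boolVertex t, boolVertex_mem ht.1⟩ q hcont
    (show (1 / 2 : ℝ) ∈ Set.Icc _ _ by
      rw [dist_self, dist_boolVertex_eq_one q.2 hq]
      norm_num)
  have hp' : dist (p : V → ℝ) (boolVertex t) = 1 / 2 := hp
  have h := heq p.2 ((isFaceVertex_iff_dist_lt_one p.2).2 (by rw [hp']; norm_num))
  rw [h, dist_self] at hp'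
  norm_num at hp'

end Collapse

theorem contractibleSpace_inducedCubicalComplex {V : Type*} [Fintype V] (X : Set (V → Bool))
    (hX : ∀ x ∈ X, ∀ y ∈ X, x ⊓ y ∈ X) [ConnectedSpace (inducedCubicalComplex X)] :
    ContractibleSpace (inducedCubicalComplex X) := by
  classical
  induction hn : X.ncard using Nat.strong_induction_on generalizing X with
  | _ n ih =>
  obtain ⟨p⟩ := ConnectedSpace.toNonempty (α := inducedCubicalComplex X)
  have hXne : X.Nonempty :=
    ⟨fun i ↦ decide ((p : V → ℝ) i = 1), p.2.2 _ fun i ↦ ⟨fun h ↦ by simp [h], by simp⟩⟩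
  obtain ⟨t, ht⟩ := X.toFinite.exists_maximal hXne
  rcases (downSet X t).eq_empty_or_nonempty with he | hne
  · have := subsingleton_of_downSet_eq_empty ht he
    infer_instance
  · let e := collapseHomotopyEquiv hX ht hne
    have hsurj : Function.Surjective e.toFun := fun q ↦ by
      obtain ⟨h1, h2⟩ := mem_inducedCubicalComplex_diff_singleton.1 q.2
      exact ⟨⟨q, h1⟩, Subtype.ext (collapse_eq_self h1 h2 1)⟩
    have := hsurj.connectedSpace e.toFun.continuous
    have hX' : ∀ x ∈ X \ {t}, ∀ y ∈ X \ {t}, x ⊓ y ∈ X \ {t} := by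
      rintro x ⟨hx, hxt⟩ y ⟨hy, -⟩
      refine ⟨hX x hx y hy, fun h ↦ hxt ?_⟩
      have htx : t ≤ x := (Set.mem_singleton_iff.1 h).symm.trans_le inf_le_left
      exact (ht.2 hx htx).antisymm htx
    have := ih _ (hn ▸ Set.ncard_sdiff_singleton_lt_of_mem ht.1) (X \ {t}) hX' rfl
    exact e.contractibleSpace

/-- The solution space of a Horn SAT formula (at most one positive literal per clause)
is never homotopy equivalent to a sphere of dimension `p ≥ 1`. -/
theorem hornSat_not_homotopyEquiv_sphere
    (d : ℕ) (Φ : Finset (Finset (Fin d × Bool)))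
    (hHorn : ∀ C ∈ Φ, (C.filter fun l => l.2 = true).card ≤ 1) (p : ℕ) (hp : 1 ≤ p) :
    ¬ Nonempty (ContinuousMap.HomotopyEquiv
      (inducedCubicalComplex (cnfDisc Φ))
      (Metric.sphere (0 : EuclideanSpace ℝ (Fin (p + 1))) 1)) := by
  rintro ⟨e⟩
  have hrank : 1 < Module.rank ℝ (EuclideanSpace ℝ (Fin (p + 1))) := by
    rw [← Module.finrank_eq_rank, finrank_euclideanSpace_fin]
    exact_mod_cast Nat.lt_add_of_pos_left hp
  have := isPathConnected_iff_pathConnectedSpace.1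
    (isPathConnected_sphere hrank (0 : EuclideanSpace ℝ (Fin (p + 1))) zero_le_one)
  have := e.pathConnectedSpace
  have := contractibleSpace_inducedCubicalComplex (cnfDisc Φ)
    fun x hx y hy ↦ inf_mem_cnfDisc_of_horn hHorn hx hy
  exact not_contractibleSpace_sphere e.symm.contractibleSpace
end
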